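/- arXiv:math/0003096 — 10 statements merged into one kernel-verified Lean document; each statement's English description precedes it below -/
import Mathlib

section
/- Let n ≥ 1 and equip ℝ^{n+2} with the quadratic form q(v) = v₁² + ⋯ + v_{n+1}² − v_{n+2}² of signature (n+1,1). If T : ℝ^{n+2} → ℝ^{n+2} is a linear map satisfying q(T v) = q(v) for all v, and T maps every isotropic line into itself (i.e. for every v with q(v) = 0 one has T v ∈ ℝ·v), then T = id or T = −id. -/
/-- If a linear map of `ℝ^{n+2}` preserves the quadratic form
`q(v) = v₁² + ⋯ + v_{n+1}² − v_{n+2}²` of signature `(n+1,1)` and maps every isotropic line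
into itself, then it is `± id`. -/
theorem stmt3 (n : ℕ) (hn : 1 ≤ n)
    (T : (Fin (n + 2) → ℝ) →ₗ[ℝ] (Fin (n + 2) → ℝ))
    (q : (Fin (n + 2) → ℝ) → ℝ)
    (hq : ∀ v, q v = (∑ i : Fin (n + 1), v i.castSucc ^ 2) - v (Fin.last (n + 1)) ^ 2)
    (hT : ∀ v, q (T v) = q v)
    (hline : ∀ v, q v = 0 → ∃ c : ℝ, T v = c • v) :
    T = LinearMap.id ∨ T = -LinearMap.id := by
  classical
  set f : Fin (n + 2) → ℝ := Pi.single (Fin.last (n + 1)) 1 with hf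
  let e : Fin (n + 1) → Fin (n + 2) → ℝ := fun i => Pi.single i.castSucc 1
  have fl : f (Fin.last (n + 1)) = 1 := by simp [hf]
  have fc : ∀ j : Fin (n + 1), f j.castSucc = 0 := fun j => by
    simp [hf, Pi.single_apply, Fin.castSucc_ne_last]
  have el : ∀ i, e i (Fin.last (n + 1)) = 0 := fun i => by
    simp [e, Pi.single_apply, (Fin.castSucc_ne_last i).symm]
  have ec : ∀ i j : Fin (n + 1), e i j.castSucc = if j = i then 1 else 0 := fun i j => by
    simp [e, Pi.single_apply]
  have key : ∀ i, ∃ a b : ℝ, ∀ k, T f k + T (e i) k = a * (f k + e i k) ∧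
      T f k - T (e i) k = b * (f k - e i k) := by
    intro i
    obtain ⟨a, ha⟩ := hline (f + e i) (by rw [hq]; simp [fl, fc, el, ec])
    obtain ⟨b, hb⟩ := hline (f - e i) (by rw [hq]; simp [fl, fc, el, ec])
    refine ⟨a, b, fun k => ⟨?_, ?_⟩⟩
    · simpa using congrFun ha k
    · simpa using congrFun hb k
  have Tfc : ∀ j : Fin (n + 1), T f j.castSucc = 0 := by
    intro j
    have : Nontrivial (Fin (n + 1)) := Fin.nontrivial_iff_two_le.2 (by omega)
    obtain ⟨i, hi⟩ := exists_ne j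
    obtain ⟨a, b, h⟩ := key i
    obtain ⟨h1, h2⟩ := h j.castSucc
    rw [fc, ec, if_neg hi.symm] at h1 h2
    linarith
  set c := T f (Fin.last (n + 1)) with hc
  have Tf : ∀ k, T f k = c * f k := by
    intro k
    refine Fin.lastCases ?_ (fun j => ?_) k
    · rw [fl, mul_one]
    · rw [Tfc, fc, mul_zero]
  have Te : ∀ i k, T (e i) k = c * e i k := by
    intro i k
    obtain ⟨a, b, h⟩ := key i
    obtain ⟨h1, h2⟩ := h i.castSucc
    rw [fc, ec, if_pos rfl, Tfc] at h1 h2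
    obtain ⟨h3, h4⟩ := h (Fin.last (n + 1))
    rw [fl, el, ← hc] at h3 h4
    have hab : a = b := by linarith
    have hca : c = a := by subst hab; linarith
    have h5 := (h k).1
    rw [Tf, ← hca] at h5
    linarith
  have hTc : T = c • LinearMap.id := by
    refine LinearMap.pi_ext' fun m => LinearMap.ext_ring ?_
    funext k
    refine Fin.lastCases ?_ (fun j => ?_) m
    · simpa using Tf k
    · simpa using Te j k
  have hc2 : c ^ 2 = 1 := by
    have := hT f
    rw [hq, hq] at this
    simp only [Tfc, fc, fl, ← hc] at this
    simpa using this
  rcases (show c = 1 ∨ c = -1 from by simpa using hc2) with h | h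
  · left; rw [hTc, h, one_smul]
  · right; rw [hTc, h]; ext; simp
end

section
/- Let U ⊆ ℂ ≅ ℝ² be open, let f : U → ℝⁿ be a C² conformal immersion, let f^c : U → ℝⁿ be C², and let μ : U → ℂ be a C¹ function such that f^c_z = μ·f_z̄ at every point of U (the duality relation satisfied by any Christoffel pair). Then the function q := (f_z, f^c_z) : U → ℂ is holomorphic: ∂q/∂z̄ = ½(∂_x + i ∂_y)q = 0 on U. (q is the local coefficient of the quadratic differential Q_f = (df, df^c)^{2,0} of the isothermic surface f.) -/
open scoped RealInnerProductSpace

/-- The `ℂⁿ`-valued complex derivative coefficient `f_z = ½(f_x − i f_y)` of a map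
`f : ℂ → ℝⁿ` (viewing `ℂ ≅ ℝ²`, with `f_x, f_y` the partial derivatives). -/
noncomputable def fz (n : ℕ) (f : ℂ → EuclideanSpace ℝ (Fin n)) (p : ℂ) : Fin n → ℂ :=
  fun i => (((fderiv ℝ f p 1) i : ℂ) - Complex.I * ((fderiv ℝ f p Complex.I) i : ℂ)) / 2

/-- The `ℂⁿ`-valued coefficient `f_z̄ = ½(f_x + i f_y)`. -/
noncomputable def fzbar (n : ℕ) (f : ℂ → EuclideanSpace ℝ (Fin n)) (p : ℂ) : Fin n → ℂ :=
  fun i => (((fderiv ℝ f p 1) i : ℂ) + Complex.I * ((fderiv ℝ f p Complex.I) i : ℂ)) / 2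

lemma aux_deriv (n : ℕ) (U : Set ℂ) (hU : IsOpen U)
    (f : ℂ → EuclideanSpace ℝ (Fin n)) (hf : ContDiffOn ℝ 2 f U) (p : ℂ) (hp : p ∈ U) :
    ∃ X Y : Fin n → (ℂ →L[ℝ] ℂ), ∃ r s t : Fin n → ℝ,
      (∀ i, HasFDerivAt (fun q => (((fderiv ℝ f q 1) i : ℝ) : ℂ)) (X i) p) ∧
      (∀ i, HasFDerivAt (fun q => (((fderiv ℝ f q Complex.I) i : ℝ) : ℂ)) (Y i) p) ∧
      (∀ i, X i 1 = r i) ∧ (∀ i, X i Complex.I = s i) ∧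
      (∀ i, Y i 1 = s i) ∧ (∀ i, Y i Complex.I = t i) := by
  have hfp : ContDiffAt ℝ 2 f p := hf.contDiffAt (hU.mem_nhds hp)
  have hd : HasFDerivAt (fderiv ℝ f) (fderiv ℝ (fderiv ℝ f) p) p :=
    ((hfp.fderiv_right (m := 1) (by norm_num)).differentiableAt (by norm_num)).hasFDerivAt
  have hsym : IsSymmSndFDerivAt ℝ f p := hfp.isSymmSndFDerivAt (by simp)
  have key : ∀ (v : ℂ) (i : Fin n), HasFDerivAt (fun q => (((fderiv ℝ f q v) i : ℝ) : ℂ))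
      (Complex.ofRealCLM ∘L (EuclideanSpace.proj (𝕜 := ℝ) i ∘L
        ((ContinuousLinearMap.apply ℝ (EuclideanSpace ℝ (Fin n)) v) ∘L
        (fderiv ℝ (fderiv ℝ f) p)))) p := by
    intro v i
    exact Complex.ofRealCLM.hasFDerivAt.comp p
      ((EuclideanSpace.proj (𝕜 := ℝ) i).hasFDerivAt.comp p
        ((ContinuousLinearMap.apply ℝ (EuclideanSpace ℝ (Fin n)) v).hasFDerivAt.comp p hd))
  refine ⟨_, _, fun i => fderiv ℝ (fderiv ℝ f) p 1 1 i,
    fun i => fderiv ℝ (fderiv ℝ f) p Complex.I 1 i,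
    fun i => fderiv ℝ (fderiv ℝ f) p Complex.I Complex.I i, key 1, key Complex.I,
    fun i => rfl, fun i => rfl, fun i => ?_, fun i => rfl⟩
  simp [hsym.eq 1 Complex.I]

theorem stmt6 (n : ℕ) (U : Set ℂ) (hU : IsOpen U)
    (f fc : ℂ → EuclideanSpace ℝ (Fin n)) (μ : ℂ → ℂ)
    (hf : ContDiffOn ℝ 2 f U) (hfc : ContDiffOn ℝ 2 fc U) (hμ : ContDiffOn ℝ 1 μ U)
    (hconf : ∀ p ∈ U, ⟪fderiv ℝ f p 1, fderiv ℝ f p Complex.I⟫ = 0 ∧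
      ‖fderiv ℝ f p 1‖ ^ 2 = ‖fderiv ℝ f p Complex.I‖ ^ 2 ∧
      0 < ‖fderiv ℝ f p 1‖ ^ 2)
    (hdual : ∀ p ∈ U, ∀ i : Fin n, fz n fc p i = μ p * fzbar n f p i) :
    ∀ p ∈ U,
      fderiv ℝ (fun q => ∑ i : Fin n, fz n f q i * fz n fc q i) p 1
        + Complex.I * fderiv ℝ (fun q => ∑ i : Fin n, fz n f q i * fz n fc q i) p Complex.I
        = 0 := by
  intro p hp
  obtain ⟨X, Y, r, s, t, hX, hY, hX1, hXI, hY1, hYI⟩ := aux_deriv n U hU f hf p hp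
  obtain ⟨X', Y', r', s', t', hX', hY', hX1', hXI', hY1', hYI'⟩ := aux_deriv n U hU fc hfc p hp
  have hM : HasFDerivAt μ (fderiv ℝ μ p) p :=
    ((hμ.contDiffAt (hU.mem_nhds hp)).differentiableAt (by norm_num)).hasFDerivAt
  have hnear : ∀ᶠ q in nhds p, q ∈ U := hU.mem_nhds hp
  have hz : ∀ i, HasFDerivAt (fun q => fz n f q i) ((1 / 2 : ℂ) • (X i - Complex.I • Y i)) p := by
    intro i
    have := ((hX i).sub ((hY i).const_mul Complex.I)).const_mul (1 / 2 : ℂ)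
    refine this.congr_of_eventuallyEq (Filter.Eventually.of_forall fun q => ?_)
    simp only [fz, Pi.sub_apply]; ring
  have hz' : ∀ i, HasFDerivAt (fun q => fz n fc q i)
      ((1 / 2 : ℂ) • (X' i - Complex.I • Y' i)) p := by
    intro i
    have := ((hX' i).sub ((hY' i).const_mul Complex.I)).const_mul (1 / 2 : ℂ)
    refine this.congr_of_eventuallyEq (Filter.Eventually.of_forall fun q => ?_)
    simp only [fz, Pi.sub_apply]; ring
  have hb : ∀ i, HasFDerivAt (fun q => fzbar n f q i)
      ((1 / 2 : ℂ) • (X i + Complex.I • Y i)) p := by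
    intro i
    have := ((hX i).add ((hY i).const_mul Complex.I)).const_mul (1 / 2 : ℂ)
    refine this.congr_of_eventuallyEq (Filter.Eventually.of_forall fun q => ?_)
    simp only [fzbar, Pi.add_apply]; ring
  -- differentiated duality relation
  have hdd : ∀ i, (1 / 2 : ℂ) • (X' i - Complex.I • Y' i) =
      μ p • ((1 / 2 : ℂ) • (X i + Complex.I • Y i)) + fzbar n f p i • fderiv ℝ μ p := by
    intro i
    refine (hz' i).unique ((hM.mul (hb i)).congr_of_eventuallyEq ?_)
    filter_upwards [hnear] with q hq using hdual q hq i
  -- isotropy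
  have hiso : ∀ q ∈ U, ∑ i, fz n f q i * fz n f q i = 0 := by
    intro q hq
    obtain ⟨h1, h2, -⟩ := hconf q hq
    rw [EuclideanSpace.norm_sq_eq, EuclideanSpace.norm_sq_eq] at h2
    simp only [PiLp.inner_apply, RCLike.inner_apply, conj_trivial, Real.norm_eq_abs, sq_abs] at h1 h2
    have h1' := congrArg (fun x : ℝ => (x : ℂ)) h1
    have h2' := congrArg (fun x : ℝ => (x : ℂ)) h2
    push_cast at h1' h2'
    have : ∑ i, fz n f q i * fz n f q i =
      (1 / 4 : ℂ) * ((∑ i, (((fderiv ℝ f q 1) i : ℝ) : ℂ) ^ 2)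
        - ∑ i, (((fderiv ℝ f q Complex.I) i : ℝ) : ℂ) ^ 2)
      - (Complex.I / 2) * ∑ i, (((fderiv ℝ f q Complex.I) i : ℝ) : ℂ) *
          (((fderiv ℝ f q 1) i : ℝ) : ℂ) := by
      rw [← Finset.sum_sub_distrib, Finset.mul_sum, Finset.mul_sum, ← Finset.sum_sub_distrib]
      refine Finset.sum_congr rfl fun i _ => ?_
      simp only [fz]
      linear_combination (1 / 4 : ℂ) * (((fderiv ℝ f q Complex.I) i : ℝ) : ℂ) ^ 2 * Complex.I_sq
    rw [this, h2', h1']; ring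
  have hiso' : ∑ i, (fz n f p i • ((1 / 2 : ℂ) • (X i - Complex.I • Y i)) +
      fz n f p i • ((1 / 2 : ℂ) • (X i - Complex.I • Y i))) = 0 := by
    have h1 := HasFDerivAt.fun_sum (u := Finset.univ) fun i _ => (hz i).mul (hz i)
    refine h1.unique ((hasFDerivAt_const (0 : ℂ) p).congr_of_eventuallyEq ?_)
    filter_upwards [hnear] with q hq using hiso q hq
  have hQ := HasFDerivAt.fun_sum (u := Finset.univ) fun i _ => (hz i).mul (hz' i)
  have hQ' : fderiv ℝ (fun q => ∑ i : Fin n, fz n f q i * fz n fc q i) p = _ := hQ.fderiv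
  rw [hQ']
  have e1 := congrArg (fun L : ℂ →L[ℝ] ℂ => L 1) hiso'
  have e2 := congrArg (fun L : ℂ →L[ℝ] ℂ => L Complex.I) hiso'
  simp only [ContinuousLinearMap.sum_apply, ContinuousLinearMap.add_apply,
    ContinuousLinearMap.smul_apply, ContinuousLinearMap.sub_apply, hX1, hXI, hY1, hYI,
    hX1', hXI', hY1', hYI', smul_eq_mul, ContinuousLinearMap.zero_apply] at e1 e2 ⊢
  have hconj : ∀ i, (starRingEnd ℂ) (fzbar n f p i) = fz n f p i := by
    intro i
    simp [fz, fzbar, sub_eq_add_neg, Complex.conj_ofNat]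
  -- e3 : (f_z, f_zz) = 0, e4 : (f_z, f_zzbar) = 0
  have e3 : ∑ i, fz n f p i * ((r i : ℂ) - 2 * Complex.I * s i - t i) = 0 := by
    have : ∑ i, fz n f p i * ((r i : ℂ) - 2 * Complex.I * s i - t i) =
        (∑ i, (fz n f p i * (1 / 2 * ((r i : ℂ) - Complex.I * s i)) +
          fz n f p i * (1 / 2 * ((r i : ℂ) - Complex.I * s i)))) - Complex.I *
        ∑ i, (fz n f p i * (1 / 2 * ((s i : ℂ) - Complex.I * t i)) +
          fz n f p i * (1 / 2 * ((s i : ℂ) - Complex.I * t i))) := by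
      rw [Finset.mul_sum, ← Finset.sum_sub_distrib]
      refine Finset.sum_congr rfl fun i _ => ?_
      linear_combination -fz n f p i * t i * Complex.I_sq
    rw [this, e1, e2]; ring
  have e4 : ∑ i, fz n f p i * ((r i : ℂ) + t i) = 0 := by
    have : ∑ i, fz n f p i * ((r i : ℂ) + t i) =
        (∑ i, (fz n f p i * (1 / 2 * ((r i : ℂ) - Complex.I * s i)) +
          fz n f p i * (1 / 2 * ((r i : ℂ) - Complex.I * s i)))) + Complex.I *
        ∑ i, (fz n f p i * (1 / 2 * ((s i : ℂ) - Complex.I * t i)) +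
          fz n f p i * (1 / 2 * ((s i : ℂ) - Complex.I * t i))) := by
      rw [Finset.mul_sum, ← Finset.sum_add_distrib]
      refine Finset.sum_congr rfl fun i _ => ?_
      linear_combination fz n f p i * t i * Complex.I_sq
    rw [this, e1, e2]; ring
  have e5 : ∑ i, fzbar n f p i * ((r i : ℂ) + t i) = 0 := by
    have := congrArg (starRingEnd ℂ) e4
    simpa [map_sum, ← hconj] using this
  -- conjugated dual relation
  have hL : ∀ i, (r' i : ℂ) + t' i = 2 * (starRingEnd ℂ) (fderiv ℝ μ p 1 + Complex.I *
      fderiv ℝ μ p Complex.I) * fz n f p i +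
      (starRingEnd ℂ) (μ p) * ((r i : ℂ) - 2 * Complex.I * s i - t i) := by
    intro i
    have d1 := congrArg (fun L : ℂ →L[ℝ] ℂ => L 1) (hdd i)
    have d2 := congrArg (fun L : ℂ →L[ℝ] ℂ => L Complex.I) (hdd i)
    simp only [ContinuousLinearMap.add_apply,
      ContinuousLinearMap.smul_apply, ContinuousLinearMap.sub_apply, hX1, hXI, hY1, hYI,
      hX1', hXI', hY1', hYI', smul_eq_mul] at d1 d2
    have : (r' i : ℂ) + t' i = 2 * (fderiv ℝ μ p 1 + Complex.I *
      fderiv ℝ μ p Complex.I) * fzbar n f p i +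
      (μ p) * ((r i : ℂ) + 2 * Complex.I * s i - t i) := by
      linear_combination 2 * d1 + 2 * Complex.I * d2 + (t' i + μ p * t i) * Complex.I_sq
    have h := congrArg (starRingEnd ℂ) this
    simp only [map_add, map_sub, map_mul, Complex.conj_ofReal, hconj, Complex.conj_I,
      Complex.conj_ofNat] at h ⊢
    linear_combination h
  have hfin : ∀ i, (fz n f p i * (1 / 2 * ((r' i : ℂ) - Complex.I * s' i)) +
      fz n fc p i * (1 / 2 * ((r i : ℂ) - Complex.I * s i))) +
      Complex.I * (fz n f p i * (1 / 2 * ((s' i : ℂ) - Complex.I * t' i)) +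
      fz n fc p i * (1 / 2 * ((s i : ℂ) - Complex.I * t i))) =
      (starRingEnd ℂ) (fderiv ℝ μ p 1 + Complex.I *
        fderiv ℝ μ p Complex.I) * (fz n f p i * fz n f p i) +
      (1 / 2 * (starRingEnd ℂ) (μ p)) * (fz n f p i * ((r i : ℂ) - 2 * Complex.I * s i - t i)) +
      (1 / 2 * μ p) * (fzbar n f p i * ((r i : ℂ) + t i)) := by
    intro i
    rw [hdual p hp i]
    linear_combination (1 / 2 * fz n f p i) * hL i -
      (1 / 2 * fz n f p i * t' i + 1 / 2 * μ p * fzbar n f p i * t i) * Complex.I_sq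
  rw [Finset.mul_sum, ← Finset.sum_add_distrib, Finset.sum_congr rfl fun i _ => hfin i,
    Finset.sum_add_distrib, Finset.sum_add_distrib, ← Finset.mul_sum, ← Finset.mul_sum,
    ← Finset.mul_sum, hiso p hp, e3, e5]
  ring
end

section
/- Let U ⊆ ℝ² be open, let f, f^c : U → ℝⁿ be differentiable, let r ∈ ℝ∖{0}, and let g : U → ℝⁿ be a differentiable nowhere-vanishing solution of the r-Riccati equation dg = r·g·(df^c)·g − df. Then h := −g/(r‖g‖²) (the Clifford inverse (r g)⁻¹) is differentiable, nowhere vanishing, and solves the r-Riccati equation with the roles of f and f^c exchanged: Dh(p)X = r(‖h(p)‖²·Df(p)X − 2⟨h(p), Df(p)X⟩·h(p)) − Df^c(p)X for all p ∈ U and X ∈ ℝ². (Hence Christoffel and Darboux transforms commute: f^c + (r g)⁻¹ is a Darboux transform of f^c.) -/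
open scoped RealInnerProductSpace

/-- Symmetry of the Riccati equation: if `g` solves `dg = r·g·(df^c)·g − df` and never
vanishes, then `h = (r g)⁻¹ = −g/(r‖g‖²)` is differentiable, nowhere vanishing, and solves
the `r`-Riccati equation with `f` and `f^c` exchanged: `dh = r·h·(df)·h − df^c`. -/
theorem stmt7 (n : ℕ) (U : Set (ℝ × ℝ)) (hU : IsOpen U)
    (f fc g : ℝ × ℝ → EuclideanSpace ℝ (Fin n)) (r : ℝ) (hr : r ≠ 0)
    (hf : DifferentiableOn ℝ f U) (hfc : DifferentiableOn ℝ fc U)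
    (hg : DifferentiableOn ℝ g U) (hg0 : ∀ p ∈ U, g p ≠ 0)
    (hric : ∀ p ∈ U, ∀ X : ℝ × ℝ,
      fderiv ℝ g p X = r • (‖g p‖ ^ 2 • fderiv ℝ fc p X
        - (2 * ⟪g p, fderiv ℝ fc p X⟫) • g p) - fderiv ℝ f p X) :
    DifferentiableOn ℝ (fun q => (-(r * ‖g q‖ ^ 2)⁻¹) • g q) U ∧
    (∀ p ∈ U, (-(r * ‖g p‖ ^ 2)⁻¹) • g p ≠ 0) ∧
    (∀ p ∈ U, ∀ X : ℝ × ℝ,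
      fderiv ℝ (fun q => (-(r * ‖g q‖ ^ 2)⁻¹) • g q) p X
        = r • (‖(-(r * ‖g p‖ ^ 2)⁻¹) • g p‖ ^ 2 • fderiv ℝ f p X
            - (2 * ⟪(-(r * ‖g p‖ ^ 2)⁻¹) • g p, fderiv ℝ f p X⟫)
                • ((-(r * ‖g p‖ ^ 2)⁻¹) • g p))
          - fderiv ℝ fc p X) := by
  have hN : ∀ p ∈ U, ‖g p‖ ^ 2 ≠ 0 := fun p hp => pow_ne_zero 2 (norm_ne_zero_iff.2 (hg0 p hp))
  have key : ∀ p ∈ U, HasFDerivAt (fun q => (-(r * ‖g q‖ ^ 2)⁻¹) • g q)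
      ((-(r * ‖g p‖ ^ 2)⁻¹) • fderiv ℝ g p +
        (-((-((r * ‖g p‖ ^ 2) ^ 2)⁻¹) • (r • (2 • (innerSL ℝ (g p)).comp (fderiv ℝ g p))))).smulRight
          (g p)) p := by
    intro p hp
    have hgp : HasFDerivAt g (fderiv ℝ g p) p :=
      (hg.differentiableAt (hU.mem_nhds hp)).hasFDerivAt
    have h1 : HasFDerivAt (fun q => r * ‖g q‖ ^ 2)
        (r • (2 • (innerSL ℝ (g p)).comp (fderiv ℝ g p))) p := hgp.norm_sq.const_mul r
    have h2 := (hasDerivAt_inv (mul_ne_zero hr (hN p hp))).comp_hasFDerivAt p h1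
    exact h2.neg.smul hgp
  refine ⟨fun p hp => (key p hp).differentiableAt.differentiableWithinAt, fun p hp => ?_,
    fun p hp X => ?_⟩
  · exact smul_ne_zero (neg_ne_zero.2 (inv_ne_zero (mul_ne_zero hr (hN p hp)))) (hg0 p hp)
  · rw [(key p hp).fderiv]
    have hne := hN p hp
    have hne' : ‖g p‖ ≠ 0 := norm_ne_zero_iff.2 (hg0 p hp)
    have hn2 : ‖(-(r * ‖g p‖ ^ 2)⁻¹) • g p‖ ^ 2 = ((r * ‖g p‖ ^ 2)⁻¹) ^ 2 * ‖g p‖ ^ 2 := by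
      rw [norm_smul, mul_pow, Real.norm_eq_abs, sq_abs, neg_sq]
    rw [hn2]
    simp only [ContinuousLinearMap.add_apply, ContinuousLinearMap.smul_apply,
      ContinuousLinearMap.smulRight_apply, ContinuousLinearMap.neg_apply,
      ContinuousLinearMap.comp_apply, innerSL_apply_apply, hric p hp X, inner_sub_right,
      inner_smul_right, real_inner_smul_left, real_inner_self_eq_norm_sq, smul_eq_mul, nsmul_eq_mul]
    generalize fderiv ℝ fc p X = c
    generalize fderiv ℝ f p X = d
    generalize ⟪g p, c⟫ = a
    generalize ⟪g p, d⟫ = b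
    match_scalars <;> field_simp <;> push_cast <;> ring
end

section
/- Let U ⊆ ℝ² be open, let H, r ∈ ℝ, let f, N : U → ℝⁿ be differentiable with ‖N(p)‖ = 1 and ⟨N(p), Df(p)X⟩ = 0 for all p ∈ U and X ∈ ℝ². Set f^c := H·f + N and let g : U → ℝⁿ be a differentiable nowhere-vanishing solution of the r-Riccati equation dg = r·g·(df^c)·g − df. Define I : U → ℝ by I := −r·H·‖g‖² + 2r·⟨g, N⟩ − 1. Then I satisfies the linear differential identity dI = I·{r g, df^c}: for all p ∈ U and X ∈ ℝ², DI(p)X = −2r·⟨g(p), Df^c(p)X⟩·I(p). (Consequently I vanishes identically as soon as it vanishes at one point of a connected U — the conserved quantity of the Riccati equation for generalised H-surfaces.) -/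
open scoped RealInnerProductSpace

/-- The conserved quantity of the Riccati equation for generalised `H`-surfaces: if `N` is a
unit normal field of `f`, `f^c = H·f + N`, and `g` solves the `r`-Riccati equation
`dg = r·g·(df^c)·g − df`, then `I = −rH‖g‖² + 2r⟨g, N⟩ − 1` satisfies the linear equation
`dI = I·{r g, df^c}`, i.e. `DI(p)X = −2r⟨g p, Df^c(p)X⟩·I(p)`. -/
theorem stmt9 (n : ℕ) (U : Set (ℝ × ℝ)) (hU : IsOpen U) (H r : ℝ)
    (f N g : ℝ × ℝ → EuclideanSpace ℝ (Fin n))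
    (hfd : DifferentiableOn ℝ f U) (hNd : DifferentiableOn ℝ N U)
    (hgd : DifferentiableOn ℝ g U)
    (hN1 : ∀ p ∈ U, ‖N p‖ = 1)
    (hNperp : ∀ p ∈ U, ∀ X : ℝ × ℝ, ⟪N p, fderiv ℝ f p X⟫ = 0)
    (hg0 : ∀ p ∈ U, g p ≠ 0)
    (hric : ∀ p ∈ U, ∀ X : ℝ × ℝ,
      fderiv ℝ g p X = r • (‖g p‖ ^ 2 • fderiv ℝ (fun q => H • f q + N q) p X
        - (2 * ⟪g p, fderiv ℝ (fun q => H • f q + N q) p X⟫) • g p)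
        - fderiv ℝ f p X) :
    ∀ p ∈ U, ∀ X : ℝ × ℝ,
      fderiv ℝ (fun q => -r * H * ‖g q‖ ^ 2 + 2 * r * ⟪g q, N q⟫ - 1) p X
        = -2 * r * ⟪g p, fderiv ℝ (fun q => H • f q + N q) p X⟫
            * (-r * H * ‖g p‖ ^ 2 + 2 * r * ⟪g p, N p⟫ - 1) := by
  intro p hp X
  have hUp : U ∈ nhds p := hU.mem_nhds hp
  have hf := (hfd.differentiableAt hUp).hasFDerivAt
  have hN := (hNd.differentiableAt hUp).hasFDerivAt
  have hg := (hgd.differentiableAt hUp).hasFDerivAt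
  have hc : fderiv ℝ (fun q => H • f q + N q) p X = H • fderiv ℝ f p X + fderiv ℝ N p X := by
    have h := ((hf.const_smul H).add hN).fderiv
    have h2 := congrArg (fun L => L X) h
    exact h2
  have hNN : ⟪N p, fderiv ℝ N p X⟫ = 0 := by
    have h1 := hN.norm_sq
    have h2 : HasFDerivAt (fun q => ‖N q‖ ^ 2) (0 : ℝ × ℝ →L[ℝ] ℝ) p := by
      refine (hasFDerivAt_const (1 : ℝ) p).congr_of_eventuallyEq ?_
      filter_upwards [hUp] with q hq
      simp [hN1 q hq]
    have h3 := congrArg (fun L => L X) (h1.unique h2)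
    simpa using h3
  have hI : fderiv ℝ (fun q => -r * H * ‖g q‖ ^ 2 + 2 * r * ⟪g q, N q⟫ - 1) p X
      = -r * H * (2 * ⟪g p, fderiv ℝ g p X⟫)
        + 2 * r * (⟪g p, fderiv ℝ N p X⟫ + ⟪fderiv ℝ g p X, N p⟫) := by
    have h := (((hg.norm_sq.const_mul (-r * H)).add
      ((hg.inner ℝ hN).const_mul (2 * r))).sub_const 1).fderiv
    have h2 := congrArg (fun L => L X) h
    refine h2.trans ?_
    simp
  have hr := hric p hp X
  have hp1 := hNperp p hp X
  rw [hc] at hr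
  rw [hI, hc, hr, real_inner_comm (N p) (_ - _)]
  simp only [inner_add_right, inner_sub_right, inner_smul_right, hNN, hp1,
    real_inner_self_eq_norm_sq, real_inner_comm (g p) (N p)]
  ring
end

section
/- Let U ⊆ ℝ² be open and connected, let H ∈ ℝ, r ∈ ℝ∖{0}, and let f, N : U → ℝⁿ be continuously differentiable with ‖N‖ ≡ 1 and ⟨N(p), Df(p)X⟩ = 0 for all p, X. Set f^c := H·f + N and let g : U → ℝⁿ be a C¹ nowhere-vanishing solution of the r-Riccati equation dg = r·g·(df^c)·g − df. Suppose that at some point o ∈ U the initial condition −r·H·‖g(o)‖² + 2r·⟨g(o), N(o)⟩ = 1 holds. Then −r·H·‖g‖² + 2r·⟨g, N⟩ ≡ 1 on all of U, and, setting f̂ := f + g and N̂ := N − 2(⟨g, N⟩/‖g‖²)·g (the vector −g·N·g⁻¹ in the Clifford algebra), one has ‖N̂‖ ≡ 1 and H·f + N − g/(r·‖g‖²) = H·f̂ + N̂ on U. That is, the Christoffel transform f^c + (r g)⁻¹ of the Darboux transform f̂ equals H·f̂ + N̂, so f̂ is again a generalised H-surface with the same constant H. -/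
open scoped RealInnerProductSpace

/-- A differentiable function with `‖Du‖ ≤ K |u|`, `K` continuous, vanishing at one point of
a connected open set vanishes identically. -/
theorem zero_of_fderiv_le {U : Set (ℝ × ℝ)} (hU : IsOpen U) (hc : IsPreconnected U)
    (u K : ℝ × ℝ → ℝ) (hu : DifferentiableOn ℝ u U) (hK : ContinuousOn K U)
    (hle : ∀ q ∈ U, ‖fderiv ℝ u q‖ ≤ K q * ‖u q‖) (o : ℝ × ℝ) (ho : o ∈ U) (h0 : u o = 0) :
    ∀ p ∈ U, u p = 0 := by
  have hopen : IsOpen {x | x ∈ U ∧ u x = 0} := by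
    rw [Metric.isOpen_iff]
    rintro p ⟨hp, hup⟩
    have hev : ∀ᶠ q in nhds p, q ∈ U ∧ K q < K p + 1 :=
      Filter.Eventually.and (hU.mem_nhds hp)
        (((hK.continuousAt (hU.mem_nhds hp)).eventually_lt continuousAt_const (by simp)))
    obtain ⟨e, he, hball⟩ := Metric.eventually_nhds_iff.1 hev
    set C := |K p| + 1 with hC
    have hCpos : 0 < C := by positivity
    set d := min (e / 2) (1 / (2 * C)) with hd
    have hdpos : 0 < d := by positivity
    have hde : d < e := lt_of_le_of_lt (min_le_left _ _) (by linarith)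
    have hdC : C * d ≤ 1 / 2 := by
      have : d ≤ 1 / (2 * C) := min_le_right _ _
      calc C * d ≤ C * (1 / (2 * C)) := by gcongr
        _ = 1 / 2 := by field_simp
    have hin : ∀ q ∈ Metric.closedBall p d, q ∈ U ∧ K q < K p + 1 := fun q hq =>
      hball (lt_of_le_of_lt (Metric.mem_closedBall.1 hq) hde)
    obtain ⟨x, hx, hmax⟩ := (isCompact_closedBall p d).exists_isMaxOn
      ⟨p, Metric.mem_closedBall_self hdpos.le⟩
      (f := fun q => ‖u q‖) ((hu.continuousOn.mono fun q hq => (hin q hq).1).norm)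
    have hm : ∀ q ∈ Metric.closedBall p d, ‖u q‖ ≤ ‖u x‖ := fun q hq => hmax hq
    have hmv := (convex_closedBall p d).norm_image_sub_le_of_norm_fderiv_le (𝕜 := ℝ) (f := u)
      (C := C * ‖u x‖)
      (fun q hq => hu.differentiableAt (hU.mem_nhds (hin q hq).1))
      (fun q hq => (hle q (hin q hq).1).trans (by
        have h1 : K q ≤ C := by linarith [(hin q hq).2, le_abs_self (K p)]
        exact mul_le_mul h1 (hm q hq) (norm_nonneg _) hCpos.le))
      (Metric.mem_closedBall_self hdpos.le) hx
    rw [hup, sub_zero] at hmv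
    have hxd : ‖x - p‖ ≤ d := by rw [← dist_eq_norm]; exact hx
    have hx0 : ‖u x‖ ≤ 0 := by
      have : C * ‖u x‖ * ‖x - p‖ ≤ C * ‖u x‖ * d := by gcongr
      nlinarith [norm_nonneg (u x)]
    refine ⟨d, hdpos, fun q hq => ?_⟩
    have hq' := Metric.ball_subset_closedBall hq
    exact ⟨(hin q hq').1, norm_le_zero_iff.1 ((hm q hq').trans hx0)⟩
  have hsub := hc.subset_of_closure_inter_subset hopen ⟨o, ho, ho, h0⟩ (by
    rintro p ⟨hpc, hp⟩
    refine ⟨hp, ?_⟩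
    by_contra hne
    have hev : ∀ᶠ q in nhds p, u q ≠ 0 :=
      (hu.differentiableAt (hU.mem_nhds hp)).continuousAt.eventually_ne hne
    obtain ⟨q, hq, hq'⟩ := mem_closure_iff_nhds.1 hpc _ hev
    exact hq hq'.2)
  exact fun p hp => (hsub hp).2


/-- Bianchi's theorem on Darboux transforms of generalised `H`-surfaces: if the conserved
quantity `−rH‖g‖² + 2r⟨g, N⟩` equals `1` at one point of a connected domain, it equals `1`
everywhere; moreover with `f̂ = f + g` and `N̂ = −g·N·g⁻¹ = N − 2(⟨g,N⟩/‖g‖²)g` one has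
`‖N̂‖ ≡ 1` and `f^c + (r g)⁻¹ = H·f̂ + N̂`, so the Darboux transform `f̂` is again a
generalised `H`-surface with the same `H`. -/
theorem stmt10 (n : ℕ) (U : Set (ℝ × ℝ)) (hU : IsOpen U) (hUconn : IsConnected U)
    (H : ℝ) (r : ℝ) (hr : r ≠ 0)
    (f N g : ℝ × ℝ → EuclideanSpace ℝ (Fin n))
    (hfd : ContDiffOn ℝ 1 f U) (hNd : ContDiffOn ℝ 1 N U) (hgd : ContDiffOn ℝ 1 g U)
    (hN1 : ∀ p ∈ U, ‖N p‖ = 1)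
    (hNperp : ∀ p ∈ U, ∀ X : ℝ × ℝ, ⟪N p, fderiv ℝ f p X⟫ = 0)
    (hg0 : ∀ p ∈ U, g p ≠ 0)
    (hric : ∀ p ∈ U, ∀ X : ℝ × ℝ,
      fderiv ℝ g p X = r • (‖g p‖ ^ 2 • fderiv ℝ (fun q => H • f q + N q) p X
        - (2 * ⟪g p, fderiv ℝ (fun q => H • f q + N q) p X⟫) • g p)
        - fderiv ℝ f p X)
    (o : ℝ × ℝ) (ho : o ∈ U)
    (hinit : -r * H * ‖g o‖ ^ 2 + 2 * r * ⟪g o, N o⟫ = 1) :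
    (∀ p ∈ U, -r * H * ‖g p‖ ^ 2 + 2 * r * ⟪g p, N p⟫ = 1) ∧
    (∀ p ∈ U, ‖N p - (2 * (⟪g p, N p⟫ / ‖g p‖ ^ 2)) • g p‖ = 1) ∧
    (∀ p ∈ U, H • f p + N p - (r * ‖g p‖ ^ 2)⁻¹ • g p
      = H • (f p + g p) + (N p - (2 * (⟪g p, N p⟫ / ‖g p‖ ^ 2)) • g p)) := by
  have hf' : ∀ p ∈ U, DifferentiableAt ℝ f p := fun p hp =>
    (hfd.differentiableOn one_ne_zero).differentiableAt (hU.mem_nhds hp)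
  have hN' : ∀ p ∈ U, DifferentiableAt ℝ N p := fun p hp =>
    (hNd.differentiableOn one_ne_zero).differentiableAt (hU.mem_nhds hp)
  have hg' : ∀ p ∈ U, DifferentiableAt ℝ g p := fun p hp =>
    (hgd.differentiableOn one_ne_zero).differentiableAt (hU.mem_nhds hp)
  have hW : ∀ p ∈ U, ∀ X, fderiv ℝ (fun q => H • f q + N q) p X
      = H • fderiv ℝ f p X + fderiv ℝ N p X := by
    intro p hp X
    have := ((hf' p hp).hasFDerivAt.const_smul H).add (hN' p hp).hasFDerivAt
    have h2 : HasFDerivAt (fun q => H • f q + N q) (H • fderiv ℝ f p + fderiv ℝ N p) p := this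
    rw [h2.fderiv]
    rfl
  have hNN : ∀ p ∈ U, ∀ X, ⟪N p, fderiv ℝ N p X⟫ = 0 := by
    intro p hp X
    have h1 := (hN' p hp).hasFDerivAt.norm_sq
    have h2 : HasFDerivAt (fun q => ‖N q‖ ^ 2) (0 : ℝ × ℝ →L[ℝ] ℝ) p := by
      refine (hasFDerivAt_const (1 : ℝ) p).congr_of_eventuallyEq ?_
      filter_upwards [hU.mem_nhds hp] with q hq
      rw [hN1 q hq]; norm_num
    have h3 := DFunLike.congr_fun (h1.unique h2) X
    simpa using h3
  have key : ∀ p ∈ U, -r * H * ‖g p‖ ^ 2 + 2 * r * ⟪g p, N p⟫ - 1 = 0 := by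
    have hder : ∀ p ∈ U, ∃ L : ℝ × ℝ →L[ℝ] ℝ,
        HasFDerivAt (fun q => -r * H * ‖g q‖ ^ 2 + 2 * r * ⟪g q, N q⟫ - 1) L p ∧
        ∀ X, L X = -r * H * (2 * ⟪g p, fderiv ℝ g p X⟫)
          + 2 * r * (⟪g p, fderiv ℝ N p X⟫ + ⟪fderiv ℝ g p X, N p⟫) := by
      intro p hp
      have h1 := (hg' p hp).hasFDerivAt.norm_sq
      have h2 := (hg' p hp).hasFDerivAt.inner ℝ (hN' p hp).hasFDerivAt
      refine ⟨_, ((h1.const_mul (-r * H)).add (h2.const_mul (2 * r))).sub_const 1, fun X => ?_⟩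
      simp
    refine zero_of_fderiv_le hU hUconn.isPreconnected
      (fun q => -r * H * ‖g q‖ ^ 2 + 2 * r * ⟪g q, N q⟫ - 1)
      (fun q => 2 * |r| * ‖g q‖ * ‖fderiv ℝ (fun q => H • f q + N q) q‖) ?_ ?_ ?_ o ho
      (by simp only [hinit, sub_self])
    · intro p hp
      obtain ⟨L, hL, -⟩ := hder p hp
      exact hL.differentiableAt.differentiableWithinAt
    · have hWd : ContDiffOn ℝ 1 (fun q => H • f q + N q) U := (hfd.const_smul H).add hNd
      exact (continuousOn_const.mul hgd.continuousOn.norm).mul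
        (hWd.continuousOn_fderiv_of_isOpen hU le_rfl).norm
    · intro p hp
      obtain ⟨L, hL, hLX⟩ := hder p hp
      rw [hL.fderiv]
      refine L.opNorm_le_bound (by positivity) fun X => ?_
      have e : L X = -(2 * r * ⟪g p, fderiv ℝ (fun q => H • f q + N q) p X⟫
          * (-r * H * ‖g p‖ ^ 2 + 2 * r * ⟪g p, N p⟫ - 1)) := by
        have a1 := hNperp p hp X
        have a2 := hNN p hp X
        rw [real_inner_comm] at a1 a2
        rw [hLX, hric p hp X, hW p hp X]
        simp only [inner_sub_right, inner_sub_left, inner_smul_left, inner_smul_right,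
          inner_add_left, inner_add_right, a1, a2, real_inner_self_eq_norm_sq,
          RCLike.conj_to_real]
        ring
      rw [e, norm_neg, norm_mul, norm_mul, norm_mul, Real.norm_eq_abs r, Real.norm_two]
      have b1 := norm_inner_le_norm (𝕜 := ℝ) (g p) (fderiv ℝ (fun q => H • f q + N q) p X)
      have b2 := (fderiv ℝ (fun q => H • f q + N q) p).le_opNorm X
      have b3 : ‖⟪g p, fderiv ℝ (fun q => H • f q + N q) p X⟫‖
          ≤ ‖g p‖ * (‖fderiv ℝ (fun q => H • f q + N q) p‖ * ‖X‖) :=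
        b1.trans (by gcongr)
      calc _ ≤ 2 * |r| * (‖g p‖ * (‖fderiv ℝ (fun q => H • f q + N q) p‖ * ‖X‖))
            * ‖-r * H * ‖g p‖ ^ 2 + 2 * r * ⟪g p, N p⟫ - 1‖ := by gcongr
        _ = _ := by ring
  refine ⟨fun p hp => sub_eq_zero.1 (key p hp), fun p hp => ?_, fun p hp => ?_⟩
  · have hgn : ‖g p‖ ≠ 0 := norm_ne_zero_iff.2 (hg0 p hp)
    have : ‖N p - (2 * (⟪g p, N p⟫ / ‖g p‖ ^ 2)) • g p‖ ^ 2 = 1 := by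
      rw [norm_sub_sq_real, hN1 p hp, inner_smul_right, norm_smul, mul_pow, Real.norm_eq_abs,
        sq_abs, real_inner_comm]
      field_simp
      ring
    exact (pow_eq_one_iff_of_nonneg (norm_nonneg _) two_ne_zero).1 this
  · have hgn : ‖g p‖ ≠ 0 := norm_ne_zero_iff.2 (hg0 p hp)
    have hk := key p hp
    have : (r * ‖g p‖ ^ 2)⁻¹ = 2 * (⟪g p, N p⟫ / ‖g p‖ ^ 2) - H := by
      field_simp
      linarith
    rw [this]
    module
end

section
/- Let V be a finite-dimensional complex vector space with a nondegenerate symmetric bilinear form B. Let V = L₊ ⊕ L₀ ⊕ L₋ and V = L̂₊ ⊕ L̂₀ ⊕ L̂₋ be direct sum decompositions in which L₊, L₋, L̂₊, L̂₋ are one-dimensional B-isotropic subspaces, B is nondegenerate on L₊ ⊕ L₋ and on L̂₊ ⊕ L̂₋, and L₀ = (L₊ ⊕ L₋)^⊥, L̂₀ = (L̂₊ ⊕ L̂₋)^⊥. Let π₊, π₀, π₋ (resp. π̂₊, π̂₀, π̂₋) denote the projections determined by these decompositions, and for λ ∈ ℂ∖{0} set γ(λ) := λπ₊ + π₀ + λ⁻¹π₋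 and γ̂(λ)⁻¹ := λ⁻¹π̂₊ + π̂₀ + λπ̂₋. Let E : ℂ → End(V) be analytic at 0 with B(E(λ)u, E(λ)v) = B(u, v) for all u, v ∈ V and all λ in a neighbourhood of 0. Then the following are equivalent: (i) there is a map F : ℂ → End(V) analytic at 0 with F(0) invertible such that F(λ) = γ(λ) ∘ E(λ) ∘ γ̂(λ)⁻¹ for all λ ≠ 0 in some punctured neighbourhood of 0; (ii) E(0)(L̂₊) = L₊. -/
/-- Explicit form of the decomposition. -/
theorem decomp_aux {V : Type*} [NormedAddCommGroup V] [NormedSpace ℂ V]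
    (B : V →ₗ[ℂ] V →ₗ[ℂ] ℂ)
    (hBsymm : ∀ u v, B u v = B v u)
    (Lp L0 Lm : Submodule ℂ V)
    (πp π0 πm : V →L[ℂ] V)
    (hLp1 : Module.finrank ℂ Lp = 1) (hLm1 : Module.finrank ℂ Lm = 1)
    (hLpiso : ∀ u ∈ Lp, ∀ v ∈ Lp, B u v = 0) (hLmiso : ∀ u ∈ Lm, ∀ v ∈ Lm, B u v = 0)
    (hnd : ∀ v ∈ Lp ⊔ Lm, (∀ w ∈ Lp ⊔ Lm, B v w = 0) → v = 0)
    (hL0 : ∀ v, v ∈ L0 ↔ ∀ u ∈ Lp ⊔ Lm, B u v = 0)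
    (hπsum : ∀ v, πp v + π0 v + πm v = v)
    (hπmem : ∀ v, πp v ∈ Lp ∧ π0 v ∈ L0 ∧ πm v ∈ Lm) :
    ∃ p m : V, p ≠ 0 ∧ Lp = Submodule.span ℂ {p} ∧ B p p = 0 ∧ B m m = 0 ∧ B p m = 1 ∧
      B m p = 1 ∧ (∀ v, πp v = B m v • p) ∧ (∀ v, πm v = B p v • m) ∧
      (∀ v, π0 v = v - B m v • p - B p v • m) := by
  obtain ⟨⟨p, hp⟩, hp0, hps⟩ := finrank_eq_one_iff'.1 hLp1
  obtain ⟨⟨m, hm⟩, hm0, hms⟩ := finrank_eq_one_iff'.1 hLm1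
  have hp0' : p ≠ 0 := fun h => hp0 (by simpa using h)
  have hps' : ∀ w ∈ Lp, ∃ c : ℂ, c • p = w := fun w hw => by
    obtain ⟨c, hc⟩ := hps ⟨w, hw⟩
    exact ⟨c, congrArg Subtype.val hc⟩
  have hms' : ∀ w ∈ Lm, ∃ c : ℂ, c • m = w := fun w hw => by
    obtain ⟨c, hc⟩ := hms ⟨w, hw⟩
    exact ⟨c, congrArg Subtype.val hc⟩
  have hpm : B p m ≠ 0 := by
    intro h
    apply hp0'
    apply hnd p (Submodule.mem_sup_left hp)
    intro w hw
    obtain ⟨a, ha, b, hb, rfl⟩ := Submodule.mem_sup.1 hw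
    obtain ⟨c, rfl⟩ := hms' b hb
    simp [hLpiso p hp a ha, h]
  have hmp : B m p ≠ 0 := by rwa [hBsymm]
  have hsp : ∀ v, B p v = B p (πm v) := by
    intro v
    conv_lhs => rw [← hπsum v]
    simp [hLpiso p hp _ (hπmem v).1, (hL0 _).1 (hπmem v).2.1 p (Submodule.mem_sup_left hp)]
  have hsm : ∀ v, B m v = B m (πp v) := by
    intro v
    conv_lhs => rw [← hπsum v]
    simp [hLmiso m hm _ (hπmem v).2.2, (hL0 _).1 (hπmem v).2.1 m (Submodule.mem_sup_right hm)]
  have e1 : ∀ v, πp v = B ((B p m)⁻¹ • m) v • p := by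
    intro v
    obtain ⟨c, hc⟩ := hps' _ (hπmem v).1
    rw [map_smul, LinearMap.smul_apply, hsm v, ← hc, map_smul, hBsymm m p]
    congr 1
    simp only [smul_eq_mul]
    field_simp
  have e2 : ∀ v, πm v = B p v • ((B p m)⁻¹ • m) := by
    intro v
    obtain ⟨c, hc⟩ := hms' _ (hπmem v).2.2
    rw [hsp v, ← hc, map_smul, smul_smul]
    congr 1
    simp only [smul_eq_mul]
    field_simp
  refine ⟨p, (B p m)⁻¹ • m, hp0', ?_, hLpiso p hp p hp, ?_, ?_, ?_, e1, e2, ?_⟩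
  · apply le_antisymm
    · intro w hw
      exact Submodule.mem_span_singleton.2 (hps' w hw)
    · rw [Submodule.span_singleton_le_iff_mem]; exact hp
  · simp [hLmiso m hm m hm]
  · simp [hpm]
  · rw [hBsymm]; simp [hpm]
  · intro v
    rw [← e1, ← e2]
    nth_rw 2 [← hπsum v]
    abel

theorem div_aux {W : Type*} [NormedAddCommGroup W] [NormedSpace ℂ W]
    (f : ℂ → W) (hf : AnalyticAt ℂ f 0) (h0 : f 0 = 0) :
    ∃ g : ℂ → W, AnalyticAt ℂ g 0 ∧ ∀ᶠ z in nhds (0 : ℂ), f z = z • g z := by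
  have h1 : ((1 : ℕ) : ℕ∞) ≤ analyticOrderAt f 0 := by
    rw [Nat.cast_one, ENat.one_le_iff_ne_zero]
    exact hf.analyticOrderAt_ne_zero.2 h0
  obtain ⟨g, hg, h⟩ := (natCast_le_analyticOrderAt hf).1 h1
  exact ⟨g, hg, by simpa using h⟩

theorem gamma_aux {V : Type*} [NormedAddCommGroup V] [NormedSpace ℂ V]
    (B : V →ₗ[ℂ] V →ₗ[ℂ] ℂ) (hBsymm : ∀ u v, B u v = B v u) (p m : V)
    (hpp : B p p = 0) (hmm : B m m = 0) (hpm : B p m = 1) (hmp : B m p = 1)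
    (z w : ℂ) (hzw : z * w = 1) (u v : V) :
    B (z • (B m u • p) + (u - B m u • p - B p u • m) + w • (B p u • m))
      (z • (B m v • p) + (v - B m v • p - B p v • m) + w • (B p v • m)) = B u v := by
  simp only [map_add, map_sub, map_smul, LinearMap.add_apply, LinearMap.sub_apply,
    LinearMap.smul_apply, smul_eq_mul, hpp, hmm, hpm, hmp, hBsymm u p, hBsymm u m]
  linear_combination (B m u * B p v + B p u * B m v) * hzw

theorem clm_an_aux {W X : Type*} [NormedAddCommGroup W] [NormedSpace ℂ W]
    [NormedAddCommGroup X] [NormedSpace ℂ X] (L : W →L[ℂ] X) {f : ℂ → W}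
    (hf : AnalyticAt ℂ f 0) : AnalyticAt ℂ (fun z => L (f z)) 0 :=
  (L.analyticAt (f 0)).comp hf

theorem bil_an_aux {V : Type*} [NormedAddCommGroup V] [NormedSpace ℂ V] [FiniteDimensional ℂ V]
    (B : V →ₗ[ℂ] V →ₗ[ℂ] ℂ) {f g : ℂ → V}
    (hf : AnalyticAt ℂ f 0) (hg : AnalyticAt ℂ g 0) :
    AnalyticAt ℂ (fun z => B (f z) (g z)) 0 :=
  (B.toContinuousBilinearMap.analyticAt_bilinear (f 0, g 0)).comp₂ hf hg

theorem unit_aux {V : Type*} [NormedAddCommGroup V] [NormedSpace ℂ V] [FiniteDimensional ℂ V]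
    (T : V →L[ℂ] V) (h : ∀ v, T v = 0 → v = 0) : IsUnit T := by
  have hinj : Function.Injective (T : V →ₗ[ℂ] V) := by
    rw [← LinearMap.ker_eq_bot, LinearMap.ker_eq_bot']
    exact h
  let e := (LinearEquiv.ofInjectiveEndo (T : V →ₗ[ℂ] V) hinj).toContinuousLinearEquiv
  have he : (e : V →L[ℂ] V) = T := by ext v; rfl
  rw [← he]
  exact ⟨ContinuousLinearEquiv.toUnit e, rfl⟩

/-- The key lemma on simple factors: with `γ(λ) = λπ₊ + π₀ + λ⁻¹π₋` and
`γ̂(λ)⁻¹ = λ⁻¹π̂₊ + π̂₀ + λπ̂₋` the homomorphisms attached to two decompositions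
`V = L₊ ⊕ L₀ ⊕ L₋ = L̂₊ ⊕ L̂₀ ⊕ L̂₋` (with `L₊, L₋, L̂₊, L̂₋` one-dimensional isotropic,
`B` nondegenerate on `L₊ ⊕ L₋` and `L̂₊ ⊕ L̂₋`, and `L₀, L̂₀` the orthogonal complements),
and `E` a `B`-orthogonal-valued germ at `0`, the product `γ E γ̂⁻¹` extends holomorphically
and invertibly over `0` iff `E(0)(L̂₊) = L₊`. -/
theorem stmt14 {V : Type*} [NormedAddCommGroup V] [NormedSpace ℂ V] [FiniteDimensional ℂ V]
    (B : V →ₗ[ℂ] V →ₗ[ℂ] ℂ)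
    (hBsymm : ∀ u v, B u v = B v u)
    (hBnd : ∀ v, (∀ w, B v w = 0) → v = 0)
    (Lp L0 Lm Lhp Lh0 Lhm : Submodule ℂ V)
    (πp π0 πm πhp πh0 πhm : V →L[ℂ] V)
    (hLp1 : Module.finrank ℂ Lp = 1) (hLm1 : Module.finrank ℂ Lm = 1)
    (hLhp1 : Module.finrank ℂ Lhp = 1) (hLhm1 : Module.finrank ℂ Lhm = 1)
    (hLpiso : ∀ u ∈ Lp, ∀ v ∈ Lp, B u v = 0) (hLmiso : ∀ u ∈ Lm, ∀ v ∈ Lm, B u v = 0)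
    (hLhpiso : ∀ u ∈ Lhp, ∀ v ∈ Lhp, B u v = 0) (hLhmiso : ∀ u ∈ Lhm, ∀ v ∈ Lhm, B u v = 0)
    (hnd : ∀ v ∈ Lp ⊔ Lm, (∀ w ∈ Lp ⊔ Lm, B v w = 0) → v = 0)
    (hndh : ∀ v ∈ Lhp ⊔ Lhm, (∀ w ∈ Lhp ⊔ Lhm, B v w = 0) → v = 0)
    (hL0 : ∀ v, v ∈ L0 ↔ ∀ u ∈ Lp ⊔ Lm, B u v = 0)
    (hLh0 : ∀ v, v ∈ Lh0 ↔ ∀ u ∈ Lhp ⊔ Lhm, B u v = 0)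
    (hπsum : ∀ v, πp v + π0 v + πm v = v)
    (hπmem : ∀ v, πp v ∈ Lp ∧ π0 v ∈ L0 ∧ πm v ∈ Lm)
    (hπLp : ∀ v ∈ Lp, πp v = v ∧ π0 v = 0 ∧ πm v = 0)
    (hπL0 : ∀ v ∈ L0, π0 v = v ∧ πp v = 0 ∧ πm v = 0)
    (hπLm : ∀ v ∈ Lm, πm v = v ∧ πp v = 0 ∧ π0 v = 0)
    (hπhsum : ∀ v, πhp v + πh0 v + πhm v = v)
    (hπhmem : ∀ v, πhp v ∈ Lhp ∧ πh0 v ∈ Lh0 ∧ πhm v ∈ Lhm)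
    (hπhLp : ∀ v ∈ Lhp, πhp v = v ∧ πh0 v = 0 ∧ πhm v = 0)
    (hπhL0 : ∀ v ∈ Lh0, πh0 v = v ∧ πhp v = 0 ∧ πhm v = 0)
    (hπhLm : ∀ v ∈ Lhm, πhm v = v ∧ πhp v = 0 ∧ πh0 v = 0)
    (E : ℂ → V →L[ℂ] V) (hE : AnalyticAt ℂ E 0)
    (hEB : ∀ᶠ z in nhds (0 : ℂ), ∀ u v, B (E z u) (E z v) = B u v) :
    (∃ F : ℂ → V →L[ℂ] V, AnalyticAt ℂ F 0 ∧ IsUnit (F 0) ∧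
        ∀ᶠ z in nhdsWithin (0 : ℂ) {(0 : ℂ)}ᶜ,
          F z = (z • πp + π0 + z⁻¹ • πm).comp
            ((E z).comp (z⁻¹ • πhp + πh0 + z • πhm)))
      ↔ Submodule.map (E 0 : V →ₗ[ℂ] V) Lhp = Lp := by
  obtain ⟨p, m, hp0, hLp, hpp, hmm, hpm, hmp, ep, em, e0⟩ :=
    decomp_aux B hBsymm Lp L0 Lm πp π0 πm hLp1 hLm1 hLpiso hLmiso hnd hL0 hπsum hπmem
  obtain ⟨p', m', hp0', hLp', hpp', hmm', hpm', hmp', ep', em', e0'⟩ :=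
    decomp_aux B hBsymm Lhp Lh0 Lhm πhp πh0 πhm hLhp1 hLhm1 hLhpiso hLhmiso hndh hLh0
      hπhsum hπhmem
  have hE0 : ∀ u v, B (E 0 u) (E 0 v) = B u v := hEB.self_of_nhds
  have hinj : ∀ v, E 0 v = 0 → v = 0 := by
    intro v hv
    apply hBnd
    intro w
    rw [← hE0, hv]; simp
  have hEc : Filter.Tendsto E (nhdsWithin (0 : ℂ) {(0 : ℂ)}ᶜ) (nhds (E 0)) :=
    hE.continuousAt.tendsto.mono_left nhdsWithin_le_nhds
  have hne : ∀ᶠ z in nhdsWithin (0 : ℂ) {(0 : ℂ)}ᶜ, z ≠ 0 :=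
    eventually_mem_nhdsWithin
  have hzt : Filter.Tendsto (fun z : ℂ => z) (nhdsWithin (0 : ℂ) {(0 : ℂ)}ᶜ) (nhds 0) :=
    Filter.tendsto_id.mono_left nhdsWithin_le_nhds
  have hcB : ∀ w, Continuous (fun v => B w v) := fun w =>
    (B w).continuous_of_finiteDimensional
  constructor
  · rintro ⟨F, hF, -, hFe⟩
    have hFc : Filter.Tendsto F (nhdsWithin (0 : ℂ) {(0 : ℂ)}ᶜ) (nhds (F 0)) :=
      hF.continuousAt.tendsto.mono_left nhdsWithin_le_nhds
    have hFp : ∀ᶠ z in nhdsWithin (0 : ℂ) {(0 : ℂ)}ᶜ,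
        z • F z p' = z • πp (E z p') + π0 (E z p') + z⁻¹ • πm (E z p') := by
      filter_upwards [hFe, hne] with z hz hz0
      rw [hz]
      simp only [ContinuousLinearMap.comp_apply, ContinuousLinearMap.add_apply,
        ContinuousLinearMap.smul_apply, ep', em', e0', hpp', hmp']
      simp [smul_smul, hz0]
    have hEcp : Filter.Tendsto (fun z => E z p') (nhdsWithin (0 : ℂ) {(0 : ℂ)}ᶜ)
        (nhds (E 0 p')) :=
      ((ContinuousLinearMap.apply ℂ V p').continuous.tendsto _).comp hEc
    have hFcp : Filter.Tendsto (fun z => F z p') (nhdsWithin (0 : ℂ) {(0 : ℂ)}ᶜ)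
        (nhds (F 0 p')) :=
      ((ContinuousLinearMap.apply ℂ V p').continuous.tendsto _).comp hFc
    have hm0 : B p (E 0 p') = 0 := by
      have h1 : Filter.Tendsto (fun z => B p (E z p')) (nhdsWithin (0 : ℂ) {(0 : ℂ)}ᶜ)
          (nhds (B p (E 0 p'))) := ((hcB p).tendsto _).comp hEcp
      have h2 : Filter.Tendsto (fun z => z * z * B p (F z p'))
          (nhdsWithin (0 : ℂ) {(0 : ℂ)}ᶜ) (nhds (0 * 0 * B p (F 0 p'))) :=
        (hzt.mul hzt).mul (((hcB p).tendsto _).comp hFcp)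
      have h3 : (fun z => z * z * B p (F z p')) =ᶠ[nhdsWithin (0 : ℂ) {(0 : ℂ)}ᶜ]
          (fun z => B p (E z p')) := by
        filter_upwards [hFp, hne] with z hz hz0
        have := congrArg (B p) hz
        simp only [ep, em, e0, map_add, map_sub, map_smul, smul_eq_mul, hpp, hpm] at this
        rw [mul_assoc, this]
        field_simp
        ring
      have := tendsto_nhds_unique (h2.congr' h3) h1
      simpa using this.symm
    have h00 : π0 (E 0 p') = 0 := by
      have h1 : Filter.Tendsto (fun z => π0 (E z p')) (nhdsWithin (0 : ℂ) {(0 : ℂ)}ᶜ)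
          (nhds (π0 (E 0 p'))) := (π0.continuous.tendsto _).comp hEcp
      have h2 : Filter.Tendsto (fun z => z • π0 (F z p'))
          (nhdsWithin (0 : ℂ) {(0 : ℂ)}ᶜ) (nhds ((0:ℂ) • π0 (F 0 p'))) :=
        hzt.smul ((π0.continuous.tendsto _).comp hFcp)
      have h3 : (fun z => z • π0 (F z p')) =ᶠ[nhdsWithin (0 : ℂ) {(0 : ℂ)}ᶜ]
          (fun z => π0 (E z p')) := by
        filter_upwards [hFp, hne] with z hz hz0
        have := congrArg π0 hz
        simp only [map_add, map_smul, (hπLp _ (hπmem _).1).2.1, (hπLm _ (hπmem _).2.2).2.2,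
          (hπL0 _ (hπmem _).2.1).1] at this
        simpa using this
      have := tendsto_nhds_unique (h2.congr' h3) h1
      simpa using this.symm
    have hk : E 0 p' = B m (E 0 p') • p := by
      have := hπsum (E 0 p')
      rw [h00, em, hm0, ep] at this
      simpa using this.symm
    have hc : B m (E 0 p') ≠ 0 := by
      intro h
      rw [h, zero_smul] at hk
      exact hp0' (hinj _ hk)
    rw [hLp, hLp', Submodule.map_span, Set.image_singleton]
    change Submodule.span ℂ {E 0 p'} = _
    rw [hk]
    exact Submodule.span_singleton_smul_eq (IsUnit.mk0 _ hc) p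
  · intro hmap
    have hmem : E 0 p' ∈ Lp := by
      rw [← hmap]
      exact ⟨p', by rw [hLp']; exact Submodule.mem_span_singleton_self _, rfl⟩
    rw [hLp] at hmem
    obtain ⟨c, hc⟩ := Submodule.mem_span_singleton.1 hmem
    have hc0 : c ≠ 0 := by
      rintro rfl
      rw [zero_smul] at hc
      exact hp0' (hinj _ hc.symm)
    have anL : ∀ (S T : V →L[ℂ] V), AnalyticAt ℂ (fun z => S.comp ((E z).comp T)) 0 := by
      intro S T
      have h1 : AnalyticAt ℂ (fun z => (E z).comp T) 0 :=
        clm_an_aux ((ContinuousLinearMap.compL ℂ V V V).flip T) hE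
      exact clm_an_aux ((ContinuousLinearMap.compL ℂ V V V) S) h1
    obtain ⟨G, hG, hGe⟩ := div_aux (fun z => π0.comp ((E z).comp πhp)) (anL _ _) (by
      ext v
      simp [ep', ← hc, e0, hpp, hmp, smul_smul])
    obtain ⟨H, hH, hHe⟩ := div_aux (fun z => πm.comp ((E z).comp πh0)) (anL _ _) (by
      ext v
      have h1 : B p (E 0 (πh0 v)) = 0 := by
        have h2 := hE0 p' (πh0 v)
        rw [← hc, e0'] at h2
        simp [hpp', hpm'] at h2
        rw [e0']
        simpa [hc0] using h2
      simp only [ContinuousLinearMap.comp_apply]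
      rw [em, h1]; simp)
    -- analytic functions
    have anE : ∀ w v, AnalyticAt ℂ (fun z => B w (E z v)) 0 := by
      intro w v
      exact clm_an_aux ((LinearMap.toContinuousLinearMap (B w)).comp
        (ContinuousLinearMap.apply ℂ V v)) hE
    have anG : AnalyticAt ℂ (fun z => G z p') 0 :=
      clm_an_aux (ContinuousLinearMap.apply ℂ V p') hG
    have anGG : AnalyticAt ℂ (fun z => B (G z p') (G z p')) 0 :=
      bil_an_aux B anG anG
    have ha0 : B m (E 0 p') = c := by rw [← hc]; simp [hmp]
    let q : ℂ → ℂ := fun z => -(B (G z p') (G z p')) / (2 * B m (E z p'))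
    have hq : AnalyticAt ℂ q 0 :=
      anGG.neg.div (analyticAt_const.mul (anE m p')) (by rw [ha0]; simpa using hc0)
    have hane : ∀ᶠ z in nhds (0 : ℂ), B m (E z p') ≠ 0 :=
      (anE m p').continuousAt.eventually_ne (by rw [ha0]; exact hc0)
    have hqe : ∀ᶠ z in nhds (0 : ℂ), B p (E z p') = z ^ 2 * q z := by
      filter_upwards [hane, hGe, hEB] with z h1 h2 h3
      have h4 := h3 p' p'
      rw [hpp'] at h4
      have h5 : π0 (E z p') = z • G z p' := by
        have := congrArg (fun S : V →L[ℂ] V => S p') h2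
        simpa [ep', hmp'] using this
      have h6 : B (π0 (E z p')) (π0 (E z p')) = z ^ 2 * B (G z p') (G z p') := by
        rw [h5]; simp; ring
      rw [e0] at h6
      simp only [map_sub, map_smul, LinearMap.sub_apply, LinearMap.smul_apply, smul_eq_mul,
        hpp, hmm, hpm, hmp, hBsymm (E z p') p, hBsymm (E z p') m, h4] at h6
      simp only [q]
      field_simp
      linear_combination -h6
    let R : V →L[ℂ] V := (LinearMap.toContinuousLinearMap (B m')).smulRight m
    have hRe : ∀ᶠ z in nhds (0 : ℂ), πm.comp ((E z).comp πhp) = (z ^ 2 * q z) • R := by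
      filter_upwards [hqe] with z hz
      ext v
      simp only [ContinuousLinearMap.comp_apply, ContinuousLinearMap.smul_apply]
      rw [ep', map_smul, map_smul, em, hz]
      simp [R, smul_smul]
      ring_nf
    let F : ℂ → V →L[ℂ] V := fun z =>
      z ^ 2 • πp.comp ((E z).comp πhm) +
      z • (πp.comp ((E z).comp πh0) + π0.comp ((E z).comp πhm)) +
      (πp.comp ((E z).comp πhp) + π0.comp ((E z).comp πh0) + πm.comp ((E z).comp πhm)) +
      (G z + H z) + q z • R
    have hF : AnalyticAt ℂ F 0 := by
      have hid : AnalyticAt ℂ (fun z : ℂ => z) 0 := analyticAt_id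
      exact (((((hid.pow 2).smul (anL _ _)).add (hid.smul ((anL _ _).add (anL _ _)))).add
        (((anL _ _).add (anL _ _)).add (anL _ _))).add (hG.add hH)).add
        (hq.smul analyticAt_const)
    have hFe : ∀ᶠ z in nhdsWithin (0 : ℂ) {(0 : ℂ)}ᶜ,
          F z = (z • πp + π0 + z⁻¹ • πm).comp
            ((E z).comp (z⁻¹ • πhp + πh0 + z • πhm)) := by
      filter_upwards [hne, nhdsWithin_le_nhds hGe, nhdsWithin_le_nhds hHe,
        nhdsWithin_le_nhds hRe] with z hz hg hh hr
      have hg' : G z = z⁻¹ • π0.comp ((E z).comp πhp) := by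
        rw [hg, smul_smul, inv_mul_cancel₀ hz, one_smul]
      have hh' : H z = z⁻¹ • πm.comp ((E z).comp πh0) := by
        rw [hh, smul_smul, inv_mul_cancel₀ hz, one_smul]
      have hr' : q z • R = (z⁻¹ * z⁻¹) • πm.comp ((E z).comp πhp) := by
        rw [hr, smul_smul]
        congr 1
        field_simp
      simp only [F]
      rw [hg', hh', hr']
      ext v
      simp only [ContinuousLinearMap.comp_apply, ContinuousLinearMap.smul_apply,
        ContinuousLinearMap.add_apply, map_add, map_smul, smul_add, smul_smul,
        mul_inv_cancel₀ hz, inv_mul_cancel₀ hz, one_smul, pow_two]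
      abel
    refine ⟨F, hF, ?_, hFe⟩
    have hFB : ∀ u v, B (F 0 u) (F 0 v) = B u v := by
      intro u v
      have hFan : ∀ v, AnalyticAt ℂ (fun z => F z v) 0 := fun v =>
        clm_an_aux (ContinuousLinearMap.apply ℂ V v) hF
      have h1 : Filter.Tendsto (fun z => B (F z u) (F z v))
          (nhdsWithin (0 : ℂ) {(0 : ℂ)}ᶜ) (nhds (B (F 0 u) (F 0 v))) :=
        (bil_an_aux B (hFan u) (hFan v)).continuousAt.tendsto.mono_left nhdsWithin_le_nhds
      have h2 : (fun _ => B u v) =ᶠ[nhdsWithin (0 : ℂ) {(0 : ℂ)}ᶜ]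
          (fun z => B (F z u) (F z v)) := by
        filter_upwards [hne, hFe, nhdsWithin_le_nhds hEB] with z hz hfe heb
        rw [hfe]
        have k1 : ∀ w, (z • πp + π0 + z⁻¹ • πm) w =
            z • (B m w • p) + (w - B m w • p - B p w • m) + z⁻¹ • (B p w • m) := by
          intro w
          simp only [ContinuousLinearMap.add_apply, ContinuousLinearMap.smul_apply, ep, em, e0]
        have k2 : ∀ w, (z⁻¹ • πhp + πh0 + z • πhm) w =
            z⁻¹ • (B m' w • p') + (w - B m' w • p' - B p' w • m') + z • (B p' w • m') := by
          intro w
          simp only [ContinuousLinearMap.add_apply, ContinuousLinearMap.smul_apply, ep', em', e0']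
        simp only [ContinuousLinearMap.comp_apply]
        rw [k1, k1, gamma_aux B hBsymm p m hpp hmm hpm hmp z z⁻¹ (mul_inv_cancel₀ hz), heb,
          k2, k2, gamma_aux B hBsymm p' m' hpp' hmm' hpm' hmp' z⁻¹ z (inv_mul_cancel₀ hz)]
      exact (tendsto_nhds_unique (tendsto_const_nhds.congr' h2) h1).symm
    apply unit_aux
    intro v hv
    apply hBnd
    intro w
    rw [← hFB, hv, map_zero, LinearMap.zero_apply]
end

section
/- Let V be a finite-dimensional complex vector space with a nondegenerate symmetric bilinear form B, and let ρ : V → V be a linear involution with B(ρu, ρv) = B(u, v) for all u, v. For a one-dimensional B-isotropic subspace L such that B is nondegenerate on L ⊕ ρ(L), let π₊, π₋, π₀ be the projections onto L, ρ(L), and (L ⊕ ρ(L))^⊥ determined by the decomposition V = L ⊕ ρ(L) ⊕ (L ⊕ ρ(L))^⊥, and for α ∈ ℂ∖{0} and λ ∉ {α, −α} define the simple factor p_{α,L}(λ) := ((α−λ)/(α+λ))·π₊ + π₀ + ((α+λ)/(α−λ))·π₋, an invertible B-preserving endomorphism of V. Now let α₁, α₂ ∈ ℂ∖{0} with α₁²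 ≠ α₂², let L₁, L₂ be one-dimensional B-isotropic subspaces with B nondegenerate on Lᵢ ⊕ ρ(Lᵢ) (i = 1, 2), and set L₁' := p_{α₂,L₂}(α₁)(L₁) and L₂' := p_{α₁,L₁}(α₂)(L₂); assume B is nondegenerate on L₁' ⊕ ρ(L₁') and on L₂' ⊕ ρ(L₂'). Then for every λ ∈ ℂ∖{α₁, −α₁, α₂, −α₂}: p_{α₁,L₁'}(λ) ∘ p_{α₂,L₂}(λ) = p_{α₂,L₂'}(λ) ∘ p_{α₁,L₁}(λ). (Permutability of simple factors, underlying Bianchi permutability of Darboux transforms.) -/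
/-- The projection triple `(π₊, π₀, π₋)` adapted to the decomposition
`V = L ⊕ ρ(L) ⊕ (L ⊕ ρ(L))^⊥` determined by a one-dimensional `B`-isotropic subspace `L`
and the involution `ρ`. -/
def IsAdaptedTriple {V : Type*} [AddCommGroup V] [Module ℂ V]
    (B : V →ₗ[ℂ] V →ₗ[ℂ] ℂ) (ρ : V →ₗ[ℂ] V) (L : Submodule ℂ V)
    (πp π0 πm : V →ₗ[ℂ] V) : Prop :=
  (∀ v, πp v + π0 v + πm v = v) ∧
  (∀ v, πp v ∈ L) ∧ (∀ v, πm v ∈ L.map ρ) ∧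
  (∀ v, ∀ u ∈ L ⊔ L.map ρ, B u (π0 v) = 0) ∧
  (∀ v ∈ L, πp v = v ∧ π0 v = 0 ∧ πm v = 0) ∧
  (∀ v ∈ L.map ρ, πm v = v ∧ πp v = 0 ∧ π0 v = 0) ∧
  (∀ v, (∀ u ∈ L ⊔ L.map ρ, B u v = 0) → π0 v = v ∧ πp v = 0 ∧ πm v = 0)

/-- The simple factor `p_{α,L}(λ) = ((α−λ)/(α+λ))π₊ + π₀ + ((α+λ)/(α−λ))π₋`, written in
terms of the projection triple of the decomposition determined by `L` and `ρ`. -/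
noncomputable def pfac {V : Type*} [AddCommGroup V] [Module ℂ V]
    (α lam : ℂ) (πp π0 πm : V →ₗ[ℂ] V) : V →ₗ[ℂ] V :=
  ((α - lam) / (α + lam)) • πp + π0 + ((α + lam) / (α - lam)) • πm

theorem aux_formula {V : Type*} [AddCommGroup V] [Module ℂ V]
    (B : V →ₗ[ℂ] V →ₗ[ℂ] ℂ) (hBsymm : ∀ u v, B u v = B v u)
    (ρ : V →ₗ[ℂ] V) (hρB : ∀ u v, B (ρ u) (ρ v) = B u v)
    (L : Submodule ℂ V) (e : V) (hL : L = Submodule.span ℂ {e}) (hee : B e e = 0)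
    (hc : B e (ρ e) ≠ 0) (πp π0 πm : V →ₗ[ℂ] V) (h : IsAdaptedTriple B ρ L πp π0 πm)
    (α lam : ℂ) (h1 : α + lam ≠ 0) (h2 : α - lam ≠ 0) (v : V) :
    pfac α lam πp π0 πm v = v + ((-2 * lam / (α + lam)) * (B v (ρ e) / B e (ρ e))) • e
      + ((2 * lam / (α - lam)) * (B v e / B e (ρ e))) • ρ e := by
  obtain ⟨hs, hp, hm, h0, -⟩ := h
  have hp' := hp v
  have hm' := hm v
  have he : e ∈ L := by rw [hL]; exact Submodule.mem_span_singleton_self e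
  have hff : B (ρ e) (ρ e) = 0 := by rw [hρB, hee]
  have h0e := h0 v e (Submodule.mem_sup_left he)
  have h0f := h0 v (ρ e) (Submodule.mem_sup_right (Submodule.mem_map_of_mem he))
  rw [hL, Submodule.mem_span_singleton] at hp'
  rw [hL, Submodule.map_span, Set.image_singleton, Submodule.mem_span_singleton] at hm'
  obtain ⟨a, ha⟩ := hp'
  obtain ⟨b, hb⟩ := hm'
  have hv := hs v
  have hfe : B (ρ e) e = B e (ρ e) := hBsymm _ _
  have e1 : B v (ρ e) = a * B e (ρ e) := by
    rw [hBsymm]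
    conv_lhs => rw [← hv, ← ha, ← hb]
    simp [h0f, hff, hfe]
  have e2 : B v e = b * B e (ρ e) := by
    rw [hBsymm]
    conv_lhs => rw [← hv, ← ha, ← hb]
    simp [h0e, hee]
  rw [e1, e2, mul_div_cancel_right₀ _ hc, mul_div_cancel_right₀ _ hc]
  have h0v : π0 v = v - a • e - b • ρ e := by
    rw [ha, hb]; nth_rewrite 2 [← hv]; abel
  simp only [pfac, LinearMap.add_apply, LinearMap.smul_apply, h0v, ← ha, ← hb]
  match_scalars <;> field_simp <;> ring

theorem aux_gen {V : Type*} [AddCommGroup V] [Module ℂ V]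
    (B : V →ₗ[ℂ] V →ₗ[ℂ] ℂ) (hBsymm : ∀ u v, B u v = B v u)
    (ρ : V →ₗ[ℂ] V) (hρB : ∀ u v, B (ρ u) (ρ v) = B u v)
    (L : Submodule ℂ V) (e : V) (hL : L = Submodule.span ℂ {e}) (he0 : e ≠ 0) (hee : B e e = 0)
    (hnd : ∀ v ∈ L ⊔ L.map ρ, (∀ w ∈ L ⊔ L.map ρ, B v w = 0) → v = 0) :
    B e (ρ e) ≠ 0 := by
  intro hc
  apply he0
  apply hnd e (Submodule.mem_sup_left (by rw [hL]; exact Submodule.mem_span_singleton_self e))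
  intro w hw
  rw [hL, Submodule.map_span, Set.image_singleton] at hw
  obtain ⟨x, hx, y, hy, rfl⟩ := Submodule.mem_sup.1 hw
  obtain ⟨a, rfl⟩ := Submodule.mem_span_singleton.1 hx
  obtain ⟨b, rfl⟩ := Submodule.mem_span_singleton.1 hy
  simp [hee, hc]

theorem aux_norm {V : Type*} [AddCommGroup V] [Module ℂ V]
    (B : V →ₗ[ℂ] V →ₗ[ℂ] ℂ) (hBsymm : ∀ u v, B u v = B v u)
    (ρ : V →ₗ[ℂ] V) (hρB : ∀ u v, B (ρ u) (ρ v) = B u v)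
    (L : Submodule ℂ V) (h1 : Module.finrank ℂ L = 1)
    (hiso : ∀ u ∈ L, ∀ v ∈ L, B u v = 0)
    (hnd : ∀ v ∈ L ⊔ L.map ρ, (∀ w ∈ L ⊔ L.map ρ, B v w = 0) → v = 0) :
    ∃ e, L = Submodule.span ℂ {e} ∧ B e e = 0 ∧ B e (ρ e) = 1 := by
  obtain ⟨⟨e, he⟩, hne, hsp⟩ := finrank_eq_one_iff'.1 h1
  have he0 : e ≠ 0 := fun h => hne (by simpa using h)
  have hL : L = Submodule.span ℂ {e} := by
    ext w
    rw [Submodule.mem_span_singleton]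
    constructor
    · intro hw
      obtain ⟨c, hc⟩ := hsp ⟨w, hw⟩
      exact ⟨c, by simpa using congrArg Subtype.val hc⟩
    · rintro ⟨c, rfl⟩
      exact L.smul_mem c he
  have hc := aux_gen B hBsymm ρ hρB L e hL he0 (hiso e he e he) hnd
  obtain ⟨r, hr⟩ := IsAlgClosed.exists_pow_nat_eq (B e (ρ e)) (n := 2) (by norm_num)
  have hr0 : r ≠ 0 := by rintro rfl; apply hc; rw [← hr]; norm_num
  refine ⟨r⁻¹ • e, ?_, by simp [hiso e he e he], ?_⟩
  · rw [hL, Submodule.span_singleton_smul_eq (IsUnit.mk0 _ (inv_ne_zero hr0))]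
  · simp only [map_smul, LinearMap.smul_apply, smul_eq_mul, ← hr]
    field_simp

/-- The data of the dressed line. -/
theorem aux_prime {V : Type*} [AddCommGroup V] [Module ℂ V]
    (B : V →ₗ[ℂ] V →ₗ[ℂ] ℂ) (hBsymm : ∀ u v, B u v = B v u)
    (ρ : V →ₗ[ℂ] V) (hρ : ∀ v, ρ (ρ v) = v) (hρB : ∀ u v, B (ρ u) (ρ v) = B u v)
    (α₁ α₂ : ℂ) (hp : α₂ + α₁ ≠ 0) (hm : α₂ - α₁ ≠ 0)
    (L₁ L₂ : Submodule ℂ V) (e₁ e₂ : V)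
    (hL₁ : L₁ = Submodule.span ℂ {e₁}) (hL₂ : L₂ = Submodule.span ℂ {e₂})
    (h11 : B e₁ e₁ = 0) (h11' : B e₁ (ρ e₁) = 1)
    (h22 : B e₂ e₂ = 0) (h22' : B e₂ (ρ e₂) = 1)
    (πp π0 πm : V →ₗ[ℂ] V) (h : IsAdaptedTriple B ρ L₂ πp π0 πm)
    (L' : Submodule ℂ V) (hL' : L' = Submodule.map (pfac α₂ α₁ πp π0 πm) L₁)
    (hnd : ∀ v ∈ L' ⊔ L'.map ρ, (∀ w ∈ L' ⊔ L'.map ρ, B v w = 0) → v = 0)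
    (πp' π0' πm' : V →ₗ[ℂ] V) (h' : IsAdaptedTriple B ρ L' πp' π0' πm')
    (x y d : ℂ) (hx : B e₁ e₂ = x) (hy : B e₁ (ρ e₂) = y)
    (hd : d = 1 + (((α₂ - α₁) / (α₂ + α₁)) ^ 2 - 1) * y ^ 2
      + (((α₂ + α₁) / (α₂ - α₁)) ^ 2 - 1) * x ^ 2) :
    d ≠ 0 ∧ ∀ lam : ℂ, α₁ + lam ≠ 0 → α₁ - lam ≠ 0 → ∀ v,
      pfac α₁ lam πp' π0' πm' v = v
        + ((-2 * lam / (α₁ + lam)) * ((B v (ρ e₁) + (-2 * α₁ / (α₂ + α₁) * y) * B v (ρ e₂)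
            + (2 * α₁ / (α₂ - α₁) * x) * B v e₂) / d)) •
          (e₁ + (-2 * α₁ / (α₂ + α₁) * y) • e₂ + (2 * α₁ / (α₂ - α₁) * x) • ρ e₂)
        + ((2 * lam / (α₁ - lam)) * ((B v e₁ + (-2 * α₁ / (α₂ + α₁) * y) * B v e₂
            + (2 * α₁ / (α₂ - α₁) * x) * B v (ρ e₂)) / d)) •
          (ρ e₁ + (-2 * α₁ / (α₂ + α₁) * y) • ρ e₂ + (2 * α₁ / (α₂ - α₁) * x) • e₂) := by
  have g21 : B e₂ e₁ = x := by rw [hBsymm, hx]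
  have g2f1 : B e₂ (ρ e₁) = y := by rw [← hρB, hρ, hBsymm, hy]
  have gf21 : B (ρ e₂) e₁ = y := by rw [hBsymm, hy]
  have gf2f1 : B (ρ e₂) (ρ e₁) = x := by rw [hρB, g21]
  have gf22 : B (ρ e₂) e₂ = 1 := by rw [hBsymm, h22']
  have gf2f2 : B (ρ e₂) (ρ e₂) = 0 := by rw [hρB, h22]
  set E := e₁ + (-2 * α₁ / (α₂ + α₁) * y) • e₂ + (2 * α₁ / (α₂ - α₁) * x) • ρ e₂ with hE
  have hpe : pfac α₂ α₁ πp π0 πm e₁ = E := by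
    rw [aux_formula B hBsymm ρ hρB L₂ e₂ hL₂ h22 (by rw [h22']; exact one_ne_zero) πp π0 πm h
      α₂ α₁ hp hm, h22', hx, hy, div_one, div_one]
  have hLE : L' = Submodule.span ℂ {E} := by
    rw [hL', hL₁, Submodule.map_span, Set.image_singleton, hpe]
  have hρE : ρ E = ρ e₁ + (-2 * α₁ / (α₂ + α₁) * y) • ρ e₂ + (2 * α₁ / (α₂ - α₁) * x) • e₂ := by
    simp only [hE, map_add, map_smul, hρ]
  have hEE : B E E = 0 := by
    simp only [hE, map_add, map_smul, LinearMap.add_apply, LinearMap.smul_apply, smul_eq_mul,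
      h11, hx, hy, g21, gf21, gf22, gf2f2, h22, h22']
    field_simp
    ring
  have hEf : B E (ρ E) = d := by
    rw [hρE, hd]
    simp only [hE, map_add, map_smul, LinearMap.add_apply, LinearMap.smul_apply, smul_eq_mul,
      h11', hx, hy, g2f1, gf2f1, gf22, gf2f2, h22, h22']
    field_simp
    ring
  have hE0 : E ≠ 0 := by
    intro h0
    have k1 : B E e₂ = 0 := by rw [h0]; simp
    have k2 : B E (ρ e₂) = 0 := by rw [h0]; simp
    simp only [hE, map_add, map_smul, LinearMap.add_apply, LinearMap.smul_apply, smul_eq_mul,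
      hx, hy, gf22, gf2f2, h22, h22'] at k1 k2
    have hx0 : x = 0 := by
      have : x * ((α₂ + α₁) / (α₂ - α₁)) = 0 := by rw [← k1]; field_simp; ring
      exact (mul_eq_zero.1 this).resolve_right (div_ne_zero hp hm)
    have hy0 : y = 0 := by
      have : y * ((α₂ - α₁) / (α₂ + α₁)) = 0 := by rw [← k2]; field_simp; ring
      exact (mul_eq_zero.1 this).resolve_right (div_ne_zero hm hp)
    have : e₁ = 0 := by rw [hE, hx0, hy0] at h0; simpa using h0
    rw [this] at h11'
    simp at h11'
  have hc := aux_gen B hBsymm ρ hρB L' E hLE hE0 hEE hnd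
  refine ⟨hEf ▸ hc, fun lam hl1 hl2 v => ?_⟩
  rw [aux_formula B hBsymm ρ hρB L' E hLE hEE hc πp' π0' πm' h' α₁ lam hl1 hl2, hEf, hρE]
  simp only [hE, map_add, map_smul, smul_eq_mul]

/-- Permutability of simple factors: with `L₁' = p_{α₂,L₂}(α₁)(L₁)` and
`L₂' = p_{α₁,L₁}(α₂)(L₂)`, one has
`p_{α₁,L₁'}(λ) ∘ p_{α₂,L₂}(λ) = p_{α₂,L₂'}(λ) ∘ p_{α₁,L₁}(λ)` away from `±α₁, ±α₂`. -/
theorem stmt15 {V : Type*} [AddCommGroup V] [Module ℂ V] [FiniteDimensional ℂ V]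
    (B : V →ₗ[ℂ] V →ₗ[ℂ] ℂ)
    (hBsymm : ∀ u v, B u v = B v u)
    (hBnd : ∀ v, (∀ w, B v w = 0) → v = 0)
    (ρ : V →ₗ[ℂ] V) (hρ : ρ ∘ₗ ρ = LinearMap.id)
    (hρB : ∀ u v, B (ρ u) (ρ v) = B u v)
    (α₁ α₂ : ℂ) (hα₁ : α₁ ≠ 0) (hα₂ : α₂ ≠ 0) (hαne : α₁ ^ 2 ≠ α₂ ^ 2)
    (L₁ L₂ : Submodule ℂ V)
    (hL₁1 : Module.finrank ℂ L₁ = 1) (hL₂1 : Module.finrank ℂ L₂ = 1)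
    (hL₁iso : ∀ u ∈ L₁, ∀ v ∈ L₁, B u v = 0)
    (hL₂iso : ∀ u ∈ L₂, ∀ v ∈ L₂, B u v = 0)
    (hnd₁ : ∀ v ∈ L₁ ⊔ L₁.map ρ, (∀ w ∈ L₁ ⊔ L₁.map ρ, B v w = 0) → v = 0)
    (hnd₂ : ∀ v ∈ L₂ ⊔ L₂.map ρ, (∀ w ∈ L₂ ⊔ L₂.map ρ, B v w = 0) → v = 0)
    (π₁p π₁0 π₁m π₂p π₂0 π₂m : V →ₗ[ℂ] V)
    (h₁ : IsAdaptedTriple B ρ L₁ π₁p π₁0 π₁m)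
    (h₂ : IsAdaptedTriple B ρ L₂ π₂p π₂0 π₂m)
    (L₁' L₂' : Submodule ℂ V)
    (hL₁' : L₁' = Submodule.map (pfac α₂ α₁ π₂p π₂0 π₂m) L₁)
    (hL₂' : L₂' = Submodule.map (pfac α₁ α₂ π₁p π₁0 π₁m) L₂)
    (hnd₁' : ∀ v ∈ L₁' ⊔ L₁'.map ρ, (∀ w ∈ L₁' ⊔ L₁'.map ρ, B v w = 0) → v = 0)
    (hnd₂' : ∀ v ∈ L₂' ⊔ L₂'.map ρ, (∀ w ∈ L₂' ⊔ L₂'.map ρ, B v w = 0) → v = 0)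
    (π₁p' π₁0' π₁m' π₂p' π₂0' π₂m' : V →ₗ[ℂ] V)
    (h₁' : IsAdaptedTriple B ρ L₁' π₁p' π₁0' π₁m')
    (h₂' : IsAdaptedTriple B ρ L₂' π₂p' π₂0' π₂m') :
    ∀ lam : ℂ, lam ≠ α₁ → lam ≠ -α₁ → lam ≠ α₂ → lam ≠ -α₂ →
      (pfac α₁ lam π₁p' π₁0' π₁m') ∘ₗ (pfac α₂ lam π₂p π₂0 π₂m)
        = (pfac α₂ lam π₂p' π₂0' π₂m') ∘ₗ (pfac α₁ lam π₁p π₁0 π₁m) := by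

  have hρ' : ∀ v, ρ (ρ v) = v := fun v => by simpa using LinearMap.congr_fun hρ v
  obtain ⟨e₁, hL₁, h11, h11'⟩ := aux_norm B hBsymm ρ hρB L₁ hL₁1 hL₁iso hnd₁
  obtain ⟨e₂, hL₂, h22, h22'⟩ := aux_norm B hBsymm ρ hρB L₂ hL₂1 hL₂iso hnd₂
  have hp : α₂ + α₁ ≠ 0 := fun h => hαne (by linear_combination (α₁ - α₂) * h)
  have hm : α₂ - α₁ ≠ 0 := fun h => hαne (by linear_combination (-α₁ - α₂) * h)
  have hp' : α₁ + α₂ ≠ 0 := by rwa [add_comm]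
  have hm' : α₁ - α₂ ≠ 0 := fun h => hm (by linear_combination -h)
  obtain ⟨x, hx⟩ : ∃ x, B e₁ e₂ = x := ⟨_, rfl⟩
  obtain ⟨y, hy⟩ : ∃ y, B e₁ (ρ e₂) = y := ⟨_, rfl⟩
  have g21 : B e₂ e₁ = x := by rw [hBsymm, hx]
  have g2f1 : B e₂ (ρ e₁) = y := by rw [← hρB, hρ', hBsymm, hy]
  have gf21 : B (ρ e₂) e₁ = y := by rw [hBsymm, hy]
  have gf2f1 : B (ρ e₂) (ρ e₁) = x := by rw [hρB, g21]
  have gf12 : B (ρ e₁) e₂ = y := by rw [hBsymm, g2f1]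
  have gf1f2 : B (ρ e₁) (ρ e₂) = x := by rw [hρB, hx]
  have gf22 : B (ρ e₂) e₂ = 1 := by rw [hBsymm, h22']
  have gf2f2 : B (ρ e₂) (ρ e₂) = 0 := by rw [hρB, h22]
  have gf11 : B (ρ e₁) e₁ = 1 := by rw [hBsymm, h11']
  have gf1f1 : B (ρ e₁) (ρ e₁) = 0 := by rw [hρB, h11]
  obtain ⟨d, hd⟩ : ∃ d, d = 1 + (((α₂ - α₁) / (α₂ + α₁)) ^ 2 - 1) * y ^ 2
      + (((α₂ + α₁) / (α₂ - α₁)) ^ 2 - 1) * x ^ 2 := ⟨_, rfl⟩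
  have hd' : d = 1 + (((α₁ - α₂) / (α₁ + α₂)) ^ 2 - 1) * y ^ 2
      + (((α₁ + α₂) / (α₁ - α₂)) ^ 2 - 1) * x ^ 2 := by
    rw [hd, add_comm α₁ α₂, ← neg_sub α₂ α₁, neg_div, div_neg, neg_sq, neg_sq]
  obtain ⟨hd0, H1⟩ := aux_prime B hBsymm ρ hρ' hρB α₁ α₂ hp hm L₁ L₂ e₁ e₂ hL₁ hL₂ h11 h11' h22 h22'
    _ _ _ h₂ L₁' hL₁' hnd₁' _ _ _ h₁' x y d hx hy hd
  obtain ⟨-, H2⟩ := aux_prime B hBsymm ρ hρ' hρB α₂ α₁ hp' hm' L₂ L₁ e₂ e₁ hL₂ hL₁ h22 h22' h11 h11'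
    _ _ _ h₁ L₂' hL₂' hnd₂' _ _ _ h₂' x y d g21 g2f1 hd'
  intro lam k1 k2 k3 k4
  have n1 : α₁ + lam ≠ 0 := fun h => k2 (by linear_combination h)
  have n2 : α₁ - lam ≠ 0 := fun h => k1 (by linear_combination -h)
  have n3 : α₂ + lam ≠ 0 := fun h => k4 (by linear_combination h)
  have n4 : α₂ - lam ≠ 0 := fun h => k3 (by linear_combination -h)
  ext v
  rw [LinearMap.comp_apply, LinearMap.comp_apply, H1 lam n1 n2, H2 lam n3 n4,
    aux_formula B hBsymm ρ hρB L₂ e₂ hL₂ h22 (by rw [h22']; exact one_ne_zero) _ _ _ h₂ α₂ lam n3 n4,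
    aux_formula B hBsymm ρ hρB L₁ e₁ hL₁ h11 (by rw [h11']; exact one_ne_zero) _ _ _ h₁ α₁ lam n1 n2]
  simp only [map_add, map_smul, LinearMap.add_apply, LinearMap.smul_apply, smul_eq_mul,
    h11, h11', h22, h22', hx, hy, g21, g2f1, gf21, gf2f1, gf12, gf1f2, gf22, gf2f2, gf11, gf1f1,
    div_one]
  generalize B v e₁ = s₁
  generalize B v e₂ = s₂
  generalize B v (ρ e₁) = t₁
  generalize B v (ρ e₂) = t₂
  have hm2 : α₁ - α₂ = -(α₂ - α₁) := by ring
  have hp2 : α₁ + α₂ = α₂ + α₁ := by ring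
  rw [hm2, hp2]
  simp only [div_neg]
  match_scalars
  all_goals field_simp
  all_goals (rw [hd]; field_simp; ring)
end

section
/- Let U ⊆ ℝ² be open, m ≥ 1, and let Φ : U × ℂ → Matrix (Fin m) (Fin m) ℂ be a smooth map (viewing ℂ ≅ ℝ²) such that: for each p ∈ U the map λ ↦ Φ(p, λ) is holomorphic on all of ℂ; Φ(p, 0) = 1 (the identity matrix) for every p; and there is a map A assigning to each p ∈ U a linear map A(p) : ℝ² → Matrix (Fin m) (Fin m) ℂ such that the derivative in the U-variable satisfies D_p(Φ(·, λ))(X) = λ·Φ(p, λ)·A(p)(X) for all p ∈ U, λ ∈ ℂ, X ∈ ℝ² (i.e. the Maurer–Cartan form of Φ(·, λ) is λ·A). Define ψ₀ : U → Matrix (Fin m) (Fin m) ℂ by ψ₀(p) := (∂Φ/∂λ)(p, 0). Then: (1) ψ₀ is differentiable with Dψ₀(p)(X) = A(p)(X) for all p and X; and (2) if σ is an invertible m×m complex matrix with σ·Φ(p, λ)·σ⁻¹ = Φ(p, −λ) for all (p, λ), then σ·ψ₀(p)·σ⁻¹ = −ψ₀(p) for all p. (The Sym formula: an extended flat frame recovers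 its generating 𝔭-flat map, up to a constant, by differentiation in the spectral parameter at λ = 0.) -/
attribute [local instance] Matrix.normedAddCommGroup Matrix.normedSpace

theorem sym_aux1 {E : Type*} [NormedAddCommGroup E] [NormedSpace ℝ E] [NormedSpace ℂ E]
    [IsScalarTower ℝ ℂ E] [FiniteDimensional ℂ E] (U : Set (ℝ × ℝ)) (hU : IsOpen U)
    (Φ : (ℝ × ℝ) × ℂ → E)
    (hsmooth : ContDiffOn ℝ (⊤ : ℕ∞) Φ (U ×ˢ (Set.univ : Set ℂ)))
    (hhol : ∀ p ∈ U, ∀ z : ℂ, DifferentiableAt ℂ (fun w => Φ (p, w)) z)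
    (p : ℝ × ℝ) (hp : p ∈ U) (B : ℝ × ℝ → E →ₗ[ℂ] E)
    (hMC : ∀ z : ℂ, ∀ X : ℝ × ℝ,
      fderiv ℝ (fun q => Φ (q, z)) p X = z • B X (Φ (p, z))) :
    DifferentiableAt ℝ (fun q => fderiv ℂ (fun w => Φ (q, w)) 0 1) p ∧
      ∀ X : ℝ × ℝ, fderiv ℝ (fun q => fderiv ℂ (fun w => Φ (q, w)) 0 1) p X
        = B X (Φ (p, 0)) := by
  have hopen : IsOpen (U ×ˢ (Set.univ : Set ℂ)) := hU.prod isOpen_univ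
  have hCD : ∀ p ∈ U, ∀ z : ℂ, ContDiffAt ℝ (⊤ : ℕ∞) Φ (p, z) := fun p hp z =>
  hsmooth.contDiffAt (hopen.mem_nhds ⟨hp, Set.mem_univ _⟩)
  have hD : ∀ p ∈ U, ∀ z : ℂ, HasFDerivAt Φ (fderiv ℝ Φ (p, z)) (p, z) := fun p hp z =>
  ((hCD p hp z).differentiableAt (by simp)).hasFDerivAt
  -- the lambda-derivative through the full real derivative
  have hψ : ∀ q ∈ U, fderiv ℂ (fun w => Φ (q, w)) 0 1 = fderiv ℝ Φ (q, 0) (0, 1) := by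
    intro q hq
    have h1 : HasFDerivAt (fun w : ℂ => Φ (q, w))
        ((fderiv ℝ Φ (q, 0)).comp (ContinuousLinearMap.inr ℝ (ℝ × ℝ) ℂ)) 0 :=
      HasFDerivAt.comp (0 : ℂ) (hD q hq 0) (hasFDerivAt_prodMk_right q (0 : ℂ))
    have h2 := ((hhol q hq 0).hasFDerivAt).restrictScalars ℝ
    have h3 := congrArg (fun L => L (1 : ℂ)) (h2.unique h1)
    simpa using h3
  have hX : ∀ z : ℂ, ∀ X : ℝ × ℝ, fderiv ℝ Φ (p, z) (X, 0) = z • B X (Φ (p, z)) := by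
    intro z X
    have h1 : HasFDerivAt (fun q : ℝ × ℝ => Φ (q, z))
        ((fderiv ℝ Φ (p, z)).comp (ContinuousLinearMap.inl ℝ (ℝ × ℝ) ℂ)) p :=
      HasFDerivAt.comp p (hD p hp z) (hasFDerivAt_prodMk_left p z)
    rw [← hMC z X, h1.fderiv]
    simp
  have hG : HasFDerivAt (fderiv ℝ Φ) (fderiv ℝ (fderiv ℝ Φ) (p, 0)) (p, (0 : ℂ)) := by
    have : ContDiffAt ℝ 1 (fderiv ℝ Φ) (p, (0 : ℂ)) :=
      (hCD p hp 0).fderiv_right (m := 1) (by exact WithTop.coe_le_coe.2 le_top)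
    exact (this.differentiableAt (by simp)).hasFDerivAt
  have hsymm : IsSymmSndFDerivAt ℝ Φ (p, (0 : ℂ)) :=
    (hCD p hp 0).isSymmSndFDerivAt (by simp; exact WithTop.coe_le_coe.2 le_top)
  -- derivative of ψ
  have hd1 : HasFDerivAt (fun q : ℝ × ℝ => fderiv ℝ Φ (q, (0 : ℂ)))
      ((fderiv ℝ (fderiv ℝ Φ) (p, 0)).comp (ContinuousLinearMap.inl ℝ (ℝ × ℝ) ℂ)) p :=
    HasFDerivAt.comp p hG (hasFDerivAt_prodMk_left p (0 : ℂ))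
  have hd2 := hd1.clm_apply (hasFDerivAt_const ((0 : ℝ × ℝ), (1 : ℂ)) p)
  have hev : (fun q => fderiv ℂ (fun w => Φ (q, w)) 0 1) =ᶠ[nhds p]
      (fun q => fderiv ℝ Φ (q, 0) (0, 1)) := by
    filter_upwards [hU.mem_nhds hp] with q hq using hψ q hq
  have hd3 := hd2.congr_of_eventuallyEq hev
  refine ⟨hd3.differentiableAt, fun X => ?_⟩
  rw [hd3.fderiv]
  have key : fderiv ℝ (fderiv ℝ Φ) (p, 0) (0, 1) (X, 0) = B X (Φ (p, 0)) := by
    have hc : HasFDerivAt (fun w : ℂ => fderiv ℝ Φ (p, w))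
        ((fderiv ℝ (fderiv ℝ Φ) (p, 0)).comp (ContinuousLinearMap.inr ℝ (ℝ × ℝ) ℂ)) 0 :=
      HasFDerivAt.comp (0 : ℂ) hG (hasFDerivAt_prodMk_right p (0 : ℂ))
    have hc2 := hc.clm_apply (hasFDerivAt_const (X, (0 : ℂ)) (0 : ℂ))
    have he : (fun w : ℂ => fderiv ℝ Φ (p, w) (X, 0)) =
        fun w : ℂ => w • B X (Φ (p, w)) := funext fun w => hX w X
    rw [he] at hc2
    let R := LinearMap.toContinuousLinearMap (B X)
    have hR : HasFDerivAt (fun w : ℂ => B X (Φ (p, w)))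
        (R.comp (fderiv ℂ (fun w => Φ (p, w)) 0)) 0 :=
      R.hasFDerivAt.comp (0 : ℂ) (hhol p hp 0).hasFDerivAt
    have hs := ((hasFDerivAt_id (𝕜 := ℂ) (0 : ℂ)).smul hR).restrictScalars ℝ
    have h3 := congrArg (fun L => L (1 : ℂ)) (hc2.unique hs)
    simpa [R] using h3
  have hs := hsymm (X, 0) (0, 1)
  simpa [key] using hs

theorem sym_aux2 {E : Type*} [NormedAddCommGroup E] [NormedSpace ℂ E] [FiniteDimensional ℂ E]
    (f : ℂ → E) (hhol : DifferentiableAt ℂ (fun w => f w) 0) (S : E →ₗ[ℂ] E)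
    (hs : ∀ z, S (f z) = f (-z)) :
    S (fderiv ℂ (fun w => f w) 0 1) = -(fderiv ℂ (fun w => f w) 0 1) := by
  let L := LinearMap.toContinuousLinearMap
    S
  have h0 := (hhol).hasFDerivAt
  have h1 : HasFDerivAt (fun w : ℂ => f (-w)) (L.comp (fderiv ℂ (fun w => f w) 0)) 0 := by
    have : (fun w : ℂ => f (-w)) = fun w => L (f w) := by
      funext w
      exact (hs w).symm
    rw [this]
    exact L.hasFDerivAt.comp (0 : ℂ) h0
  have h0' : HasFDerivAt (fun w => f w) (fderiv ℂ (fun w => f w) 0) (-(0 : ℂ)) := by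
    simpa using h0
  have h2 := HasFDerivAt.comp (0 : ℂ) h0' (hasFDerivAt_id (𝕜 := ℂ) (0 : ℂ)).neg
  have h3 := congrArg (fun L => L (1 : ℂ)) (h1.unique h2)
  simpa [L] using h3

/-- The Sym formula: if `Φ : U × ℂ → GL_m(ℂ)` is an extended flat frame — smooth in `(p, λ)`,
holomorphic in `λ`, with `Φ(p, 0) = 1` and Maurer–Cartan form `λ·A` — then
`ψ₀(p) = (∂Φ/∂λ)(p, 0)` satisfies `dψ₀ = A`; moreover any twisting symmetry
`σ Φ(p,λ) σ⁻¹ = Φ(p,−λ)` yields `σ ψ₀ σ⁻¹ = −ψ₀`. -/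
theorem stmt16 (m : ℕ) (hm : 1 ≤ m) (U : Set (ℝ × ℝ)) (hU : IsOpen U)
    (Φ : (ℝ × ℝ) × ℂ → Matrix (Fin m) (Fin m) ℂ)
    (hsmooth : ContDiffOn ℝ (⊤ : ℕ∞) Φ (U ×ˢ (Set.univ : Set ℂ)))
    (hhol : ∀ p ∈ U, ∀ z : ℂ, DifferentiableAt ℂ (fun w => Φ (p, w)) z)
    (hbase : ∀ p ∈ U, Φ (p, 0) = 1)
    (A : (ℝ × ℝ) → (ℝ × ℝ) →ₗ[ℝ] Matrix (Fin m) (Fin m) ℂ)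
    (hMC : ∀ p ∈ U, ∀ z : ℂ, ∀ X : ℝ × ℝ,
      fderiv ℝ (fun q => Φ (q, z)) p X = z • (Φ (p, z) * A p X)) :
    (∀ p ∈ U, DifferentiableAt ℝ (fun q => fderiv ℂ (fun w => Φ (q, w)) 0 1) p ∧
      ∀ X : ℝ × ℝ, fderiv ℝ (fun q => fderiv ℂ (fun w => Φ (q, w)) 0 1) p X = A p X) ∧
    (∀ σ : Matrix (Fin m) (Fin m) ℂ, IsUnit σ →
      (∀ p ∈ U, ∀ z : ℂ, σ * Φ (p, z) * σ⁻¹ = Φ (p, -z)) →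
      ∀ p ∈ U, σ * (fderiv ℂ (fun w => Φ (p, w)) 0 1) * σ⁻¹
        = -(fderiv ℂ (fun w => Φ (p, w)) 0 1)) := by
  constructor
  · intro p hp
    have h := sym_aux1 U hU Φ hsmooth hhol p hp (fun X => LinearMap.mulRight ℂ (A p X))
      (hMC p hp)
    refine ⟨h.1, fun X => (h.2 X).trans ?_⟩
    rw [hbase p hp]
    exact one_mul _
  · intro σ hσ hs p hp
    exact sym_aux2 (fun w => Φ (p, w)) (hhol p hp 0)
      ((LinearMap.mulRight ℂ σ⁻¹).comp (LinearMap.mulLeft ℂ σ)) (hs p hp)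
end

section
/- Let U ⊆ ℝ² be open, let f, f^c : U → ℝⁿ be differentiable, and let r ∈ ℝ. Let v : U → ℝⁿ and s, t : U → ℝ be differentiable with ‖v(p)‖² = s(p)·t(p) for all p ∈ U (the light-cone condition), with t nowhere vanishing, and satisfying the linear differential system: Dv(p)X = r·s(p)·Df^c(p)X − t(p)·Df(p)X and Dt(p)X = 2r·⟨v(p), Df^c(p)X⟩ for all p ∈ U and X ∈ ℝ². Then the stereographic projection g := v/t : U → ℝⁿ solves the r-Riccati equation: Dg(p)X = r(‖g(p)‖²·Df^c(p)X − 2⟨g(p), Df^c(p)X⟩·g(p)) − Df(p)X for all p, X. (This shows that Darboux's linear differential system on the light cone of ℝ^{n+1,1} is equivalent to the Riccati equation describing Darboux transforms.) -/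
open scoped RealInnerProductSpace

/-- Darboux's linear system on the light cone is equivalent to the Riccati equation: if
`(v, s, t)` with `‖v‖² = s·t` and `t` nowhere zero solves the linear system
`dv = r s df^c − t df`, `dt = 2r⟨v, df^c⟩`, then the stereographic projection `g = v/t`
solves the `r`-Riccati equation `dg = r·g·(df^c)·g − df`. -/
theorem stmt18 (n : ℕ) (U : Set (ℝ × ℝ)) (hU : IsOpen U)
    (f fc : ℝ × ℝ → EuclideanSpace ℝ (Fin n)) (r : ℝ)
    (hfd : DifferentiableOn ℝ f U) (hfcd : DifferentiableOn ℝ fc U)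
    (v : ℝ × ℝ → EuclideanSpace ℝ (Fin n)) (s t : ℝ × ℝ → ℝ)
    (hvd : DifferentiableOn ℝ v U) (hsd : DifferentiableOn ℝ s U)
    (htd : DifferentiableOn ℝ t U)
    (hlight : ∀ p ∈ U, ‖v p‖ ^ 2 = s p * t p)
    (ht0 : ∀ p ∈ U, t p ≠ 0)
    (hv : ∀ p ∈ U, ∀ X : ℝ × ℝ,
      fderiv ℝ v p X = (r * s p) • fderiv ℝ fc p X - t p • fderiv ℝ f p X)
    (ht : ∀ p ∈ U, ∀ X : ℝ × ℝ,
      fderiv ℝ t p X = 2 * r * ⟪v p, fderiv ℝ fc p X⟫) :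
    ∀ p ∈ U, ∀ X : ℝ × ℝ,
      fderiv ℝ (fun q => (t q)⁻¹ • v q) p X
        = r • (‖(t p)⁻¹ • v p‖ ^ 2 • fderiv ℝ fc p X
            - (2 * ⟪(t p)⁻¹ • v p, fderiv ℝ fc p X⟫) • ((t p)⁻¹ • v p))
          - fderiv ℝ f p X := by
  intro p hp X
  have hp' := hU.mem_nhds hp
  have h1 := (hvd.differentiableAt hp').hasFDerivAt
  have h2 := (htd.differentiableAt hp').hasFDerivAt
  have h0 := ht0 p hp
  have h3 : HasFDerivAt (fun q => (t q)⁻¹) ((-(t p ^ 2)⁻¹) • fderiv ℝ t p) p :=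
    (hasDerivAt_inv h0).comp_hasFDerivAt p h2
  have h4 : HasFDerivAt (fun q => (t q)⁻¹ • v q) _ p := h3.smul h1
  have hn : ‖(t p)⁻¹ • v p‖ ^ 2 = s p * (t p)⁻¹ := by
    rw [norm_smul, mul_pow, hlight p hp, Real.norm_eq_abs, sq_abs]
    field_simp
  rw [h4.fderiv, hn, real_inner_smul_left]
  simp only [add_apply, smul_apply, ContinuousLinearMap.smulRight_apply, hv p hp X, ht p hp X,
    smul_eq_mul]
  match_scalars <;> field_simp
end

section
/- Let U ⊆ ℂ ≅ ℝ² be open and connected, let f : U → ℝⁿ be a C² conformal immersion, let f^c : U → ℝⁿ be C², and let μ : U → ℂ be C¹ with f^c_z = μ·f_z̄ at every point. Assume moreover that f^c is not constant on U. Then the holomorphic function q := (f_z, f^c_z) : U → ℂ does not vanish identically, and its zero set is discrete: every p ∈ U with q(p) = 0 has a punctured neighbourhood on which q is nowhere zero. Consequently the set of points where Df^c vanishes is contained in this discrete set, so the dual surface f^c is a branched conformal immersion whose branch points are isolated. -/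
open scoped RealInnerProductSpace

/-- For a Christoffel pair `(f, f^c)` with `f^c` nonconstant on connected `U`, the holomorphic
function `q = (f_z, f^c_z)` does not vanish identically, its zero set is discrete, and all
zeros of `df^c` are among the zeros of `q`: the dual surface `f^c` is a branched conformal
immersion with isolated branch points. -/
theorem stmt19 (n : ℕ) (U : Set ℂ) (hU : IsOpen U) (hUconn : IsConnected U)
    (f fc : ℂ → EuclideanSpace ℝ (Fin n)) (μ : ℂ → ℂ)
    (hf : ContDiffOn ℝ 2 f U) (hfc : ContDiffOn ℝ 2 fc U) (hμ : ContDiffOn ℝ 1 μ U)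
    (hconf : ∀ p ∈ U, ⟪fderiv ℝ f p 1, fderiv ℝ f p Complex.I⟫ = 0 ∧
      ‖fderiv ℝ f p 1‖ ^ 2 = ‖fderiv ℝ f p Complex.I‖ ^ 2 ∧
      0 < ‖fderiv ℝ f p 1‖ ^ 2)
    (hdual : ∀ p ∈ U, ∀ i : Fin n, fz n fc p i = μ p * fzbar n f p i)
    (hnc : ¬ ∃ c : EuclideanSpace ℝ (Fin n), ∀ p ∈ U, fc p = c) :
    (∃ p ∈ U, (∑ i : Fin n, fz n f p i * fz n fc p i) ≠ 0) ∧
    (∀ p ∈ U, (∑ i : Fin n, fz n f p i * fz n fc p i) = 0 →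
      ∃ ε > 0, Metric.ball p ε ⊆ U ∧
        ∀ z ∈ Metric.ball p ε, z ≠ p → (∑ i : Fin n, fz n f z i * fz n fc z i) ≠ 0) ∧
    (∀ p ∈ U, fderiv ℝ fc p = 0 → (∑ i : Fin n, fz n f p i * fz n fc p i) = 0) := by
  have hc2 : (starRingEnd ℂ) 2 = 2 := Complex.conj_ofNat 2
  have key : ∀ (g : ℂ → EuclideanSpace ℝ (Fin n)), ContDiffOn ℝ 2 g U → ∀ p ∈ U, ∀ i,
      DifferentiableAt ℝ (fun z => fz n g z i) p ∧
      (starRingEnd ℂ) (fderiv ℝ (fun z => fz n g z i) p 1 +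
        Complex.I * fderiv ℝ (fun z => fz n g z i) p Complex.I) =
      fderiv ℝ (fun z => fz n g z i) p 1 +
        Complex.I * fderiv ℝ (fun z => fz n g z i) p Complex.I := by
    intro g hg p hp i
    have hgp : ContDiffAt ℝ 2 g p := hg.contDiffAt (hU.mem_nhds hp)
    have hd : DifferentiableAt ℝ (fderiv ℝ g) p :=
      (hgp.fderiv_right (m := 1) (by norm_num)).differentiableAt (by norm_num)
    have hsym : IsSymmSndFDerivAt ℝ g p :=
      hgp.isSymmSndFDerivAt (by simp)
    have hcomp : ∀ v : ℂ, HasFDerivAt (fun z => (((fderiv ℝ g z v) i : ℝ) : ℂ))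
        (Complex.ofRealCLM.comp ((EuclideanSpace.proj i : EuclideanSpace ℝ (Fin n) →L[ℝ] ℝ).comp
          ((ContinuousLinearMap.apply ℝ _ v).comp (fderiv ℝ (fderiv ℝ g) p)))) p := by
      intro v
      have h1 := (ContinuousLinearMap.apply ℝ (EuclideanSpace ℝ (Fin n)) v).hasFDerivAt.comp p
        hd.hasFDerivAt
      have h2 := (EuclideanSpace.proj i : EuclideanSpace ℝ (Fin n) →L[ℝ] ℝ).hasFDerivAt.comp p h1
      exact Complex.ofRealCLM.hasFDerivAt.comp p h2
    have hz := (((hcomp 1).sub ((hcomp Complex.I).const_mul Complex.I)).mul_const ((2:ℂ)⁻¹))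
    have hz' : HasFDerivAt (fun z => fz n g z i) _ p := hz
    refine ⟨hz'.differentiableAt, ?_⟩
    rw [hz'.fderiv]
    have hs := hsym 1 Complex.I
    simp [hs, hc2]
    ring_nf
  have hconj : ∀ (g : ℂ → EuclideanSpace ℝ (Fin n)) (p : ℂ) i,
      (starRingEnd ℂ) (fz n g p i) = fzbar n g p i := by
    intro g p i
    simp [fz, fzbar, hc2]
  have hsq : ∀ p ∈ U, ∑ i, fzbar n f p i * fzbar n f p i = 0 := by
    intro p hp
    obtain ⟨h1, h2, -⟩ := hconf p hp
    rw [EuclideanSpace.norm_sq_eq, EuclideanSpace.norm_sq_eq] at h2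
    rw [PiLp.inner_apply] at h1
    simp only [Real.norm_eq_abs, sq_abs] at h2
    simp only [RCLike.inner_apply, conj_trivial] at h1
    have h1' := congrArg (fun x : ℝ => (x : ℂ)) h1
    have h2' := congrArg (fun x : ℝ => (x : ℂ)) h2
    push_cast at h1' h2'
    have : ∀ i, fzbar n f p i * fzbar n f p i =
        (((fderiv ℝ f p 1 i : ℝ) : ℂ) ^ 2 - ((fderiv ℝ f p Complex.I i : ℝ) : ℂ) ^ 2) / 4
        + Complex.I / 2 *
          (((fderiv ℝ f p Complex.I i : ℝ) : ℂ) * ((fderiv ℝ f p 1 i : ℝ) : ℂ)) := by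
      intro i
      simp only [fzbar]
      linear_combination ((fderiv ℝ f p Complex.I i : ℝ) : ℂ) ^ 2 / 4 * Complex.I_sq
    simp_rw [this]
    rw [Finset.sum_add_distrib, ← Finset.sum_div, Finset.sum_sub_distrib, ← Finset.mul_sum,
      h1', h2']
    simp
  have hpos : ∀ p ∈ U, ∑ i, fz n f p i * fzbar n f p i ≠ 0 := by
    intro p hp h0
    obtain ⟨-, h2, h3⟩ := hconf p hp
    have h4 : ‖fderiv ℝ f p 1‖ ^ 2 + ‖fderiv ℝ f p Complex.I‖ ^ 2 ≠ 0 := by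
      rw [← h2]; positivity
    apply h4
    rw [EuclideanSpace.norm_sq_eq, EuclideanSpace.norm_sq_eq]
    simp only [Real.norm_eq_abs, sq_abs]
    have : ∀ i, fz n f p i * fzbar n f p i =
        (((fderiv ℝ f p 1 i : ℝ) : ℂ) ^ 2 + ((fderiv ℝ f p Complex.I i : ℝ) : ℂ) ^ 2) / 4 := by
      intro i
      simp only [fz, fzbar]
      linear_combination -((fderiv ℝ f p Complex.I i : ℝ) : ℂ) ^ 2 / 4 * Complex.I_sq
    simp_rw [this] at h0
    rw [← Finset.sum_div, Finset.sum_add_distrib] at h0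
    have h5 := (div_eq_zero_iff.1 h0).resolve_right (by norm_num)
    exact_mod_cast h5
  have hq : ∀ p ∈ U, (∑ i, fz n f p i * fz n fc p i) = μ p * ∑ i, fz n f p i * fzbar n f p i := by
    intro p hp
    rw [Finset.mul_sum]
    refine Finset.sum_congr rfl fun i _ => ?_
    rw [hdual p hp i]; ring
  have hhol : DifferentiableOn ℂ (fun p => ∑ i, fz n f p i * fz n fc p i) U := by
    intro p hp
    apply DifferentiableAt.differentiableWithinAt
    rw [differentiableAt_complex_iff_differentiableAt_real]
    have hA := fun i => (key f hf p hp i).1.hasFDerivAt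
    have hG := fun i => (key fc hfc p hp i).1.hasFDerivAt
    have hm := ((hμ.contDiffAt (hU.mem_nhds hp)).differentiableAt (by norm_num)).hasFDerivAt
    have hAr := fun i => (key f hf p hp i).2
    have hGr := fun i => (key fc hfc p hp i).2
    have hB : ∀ i, HasFDerivAt (fun z => fzbar n f z i)
        ((Complex.conjCLE : ℂ →L[ℝ] ℂ).comp (fderiv ℝ (fun z => fz n f z i) p)) p := by
      intro i
      have h := (Complex.conjCLE : ℂ →L[ℝ] ℂ).hasFDerivAt.comp p (hA i)
      have e : (fun z => fzbar n f z i) =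
          (Complex.conjCLE : ℂ →L[ℝ] ℂ) ∘ (fun z => fz n f z i) := by
        funext z; simp [← hconj]
      rw [e]; exact h
    have hQ := HasFDerivAt.fun_sum (u := Finset.univ) fun i _ => (hA i).mul (hG i)
    have hBB := HasFDerivAt.fun_sum (u := Finset.univ) fun i _ => (hB i).mul (hB i)
    have hBB0 := hBB.unique ((hasFDerivAt_const (0:ℂ) p).congr_of_eventuallyEq
      (Filter.eventuallyEq_of_mem (hU.mem_nhds hp) fun z hz => hsq z hz))
    have hG2 := fun i => (hG i).unique ((hm.mul (hB i)).congr_of_eventuallyEq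
      (Filter.eventuallyEq_of_mem (hU.mem_nhds hp) fun z hz => hdual z hz i))
    refine ⟨hQ.differentiableAt, ?_⟩
    have hQ' : fderiv ℝ (fun p => ∑ i, fz n f p i * fz n fc p i) p = _ := hQ.fderiv
    rw [hQ']
    generalize hDA : (fun i => fderiv ℝ (fun z => fz n f z i) p) = DA at *
    generalize hDG : (fun i => fderiv ℝ (fun z => fz n fc z i) p) = DG at *
    have hDA' := fun i => congrFun hDA i
    have hDG' := fun i => congrFun hDG i
    simp only [hDA', hDG'] at *
    have b1 := congrArg (fun L : ℂ →L[ℝ] ℂ => L 1) hBB0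
    have b2 := congrArg (fun L : ℂ →L[ℝ] ℂ => L Complex.I) hBB0
    have g1 := fun i => congrArg (fun L : ℂ →L[ℝ] ℂ => L 1) (hG2 i)
    have g2 := fun i => congrArg (fun L : ℂ →L[ℝ] ℂ => L Complex.I) (hG2 i)
    simp [← Finset.mul_sum, ← two_mul, Finset.sum_add_distrib] at b1 b2 g1 g2
    have b0 := hsq p hp
    have first : ∑ i, (DA i 1 + Complex.I * DA i Complex.I) * fz n fc p i = 0 := by
      have e : ∀ i, (DA i 1 + Complex.I * DA i Complex.I) * fz n fc p i =
          μ p * (fzbar n f p i * (starRingEnd ℂ) (DA i 1)) -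
          Complex.I * μ p * (fzbar n f p i * (starRingEnd ℂ) (DA i Complex.I)) := by
        intro i
        rw [← hAr i, hdual p hp i]
        simp
        ring
      simp_rw [e]
      rw [Finset.sum_sub_distrib, ← Finset.mul_sum, ← Finset.mul_sum, b1, b2]
      simp
    have second : ∑ i, fz n f p i * (DG i 1 + Complex.I * DG i Complex.I) = 0 := by
      apply (starRingEnd ℂ).injective
      rw [map_sum, map_zero]
      have e : ∀ i, (starRingEnd ℂ) (fz n f p i * (DG i 1 + Complex.I * DG i Complex.I)) =
          μ p * (fzbar n f p i * (starRingEnd ℂ) (DA i 1)) +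
          Complex.I * μ p * (fzbar n f p i * (starRingEnd ℂ) (DA i Complex.I)) +
          ((fderiv ℝ μ p) 1 + Complex.I * (fderiv ℝ μ p) Complex.I) * (fzbar n f p i * fzbar n f p i) := by
        intro i
        rw [map_mul, hGr i, hconj, g1, g2]
        ring
      simp_rw [e]
      rw [Finset.sum_add_distrib, Finset.sum_add_distrib, ← Finset.mul_sum, ← Finset.mul_sum,
        ← Finset.mul_sum, b1, b2, b0]
      simp
    have tot : ∑ i, ((DA i 1 + Complex.I * DA i Complex.I) * fz n fc p i +
        fz n f p i * (DG i 1 + Complex.I * DG i Complex.I)) = 0 := by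
      rw [Finset.sum_add_distrib, first, second, add_zero]
    have tot2 : (∑ i, (fz n f p i * DG i 1 + fz n fc p i * DA i 1)) +
        Complex.I * (∑ i, (fz n f p i * DG i Complex.I + fz n fc p i * DA i Complex.I)) = 0 := by
      rw [← tot, Finset.mul_sum, ← Finset.sum_add_distrib]
      exact Finset.sum_congr rfl fun i _ => by ring
    simp only [ContinuousLinearMap.sum_apply, ContinuousLinearMap.add_apply,
      ContinuousLinearMap.smul_apply, smul_eq_mul]
    linear_combination (-Complex.I) * tot2 +
      (∑ i, (fz n f p i * DG i Complex.I + fz n fc p i * DA i Complex.I)) * Complex.I_sq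
  have hne : ∃ p ∈ U, (∑ i : Fin n, fz n f p i * fz n fc p i) ≠ 0 := by
    by_contra hcon
    push Not at hcon
    apply hnc
    have hfd : Set.EqOn (fderiv ℝ fc) 0 U := by
      intro p hp
      have h0 := hcon p hp
      rw [hq p hp] at h0
      have hm0 := (mul_eq_zero.1 h0).resolve_right (hpos p hp)
      have hz : ∀ i, fderiv ℝ fc p 1 i = 0 ∧ fderiv ℝ fc p Complex.I i = 0 := by
        intro i
        have h := hdual p hp i
        rw [hm0, zero_mul] at h
        simp only [fz] at h
        have hr := congrArg Complex.re h
        have hi := congrArg Complex.im h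
        simp at hr hi
        exact ⟨hr, hi⟩
      ext v i
      have hv : v = v.re • (1:ℂ) + v.im • Complex.I := by
        simp [Complex.re_add_im]
      rw [hv, map_add, map_smul, map_smul]
      simp [hz i]
    exact hU.exists_is_const_of_fderiv_eq_zero hUconn.isPreconnected
      (hfc.differentiableOn (by norm_num)) hfd
  refine ⟨hne, ?_, ?_⟩
  · intro p hp h0
    have han := hhol.analyticOnNhd hU
    have hev : ∀ᶠ z in nhdsWithin p {p}ᶜ, (∑ i : Fin n, fz n f z i * fz n fc z i) ≠ 0 := by
      by_contra hfr
      have hfr' : ∃ᶠ z in nhdsWithin p {p}ᶜ, (∑ i : Fin n, fz n f z i * fz n fc z i) = 0 :=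
        Filter.not_eventually.1 hfr |>.mono fun z hz => not_not.1 hz
      obtain ⟨w, hw, hw0⟩ := hne
      exact hw0 (han.eqOn_zero_of_preconnected_of_frequently_eq_zero hUconn.isPreconnected hp
        hfr' hw)
    rw [eventually_nhdsWithin_iff] at hev
    obtain ⟨ε, hε, hb⟩ := Metric.mem_nhds_iff.1 (Filter.inter_mem hev (hU.mem_nhds hp))
    exact ⟨ε, hε, fun z hz => (hb hz).2, fun z hz hzp => (hb hz).1 hzp⟩
  · intro p hp h
    apply Finset.sum_eq_zero
    intro i _
    simp [fz, h]
end
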